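/- There exists an intuitionistic propositional formula A containing only 3 propositional variables such that the superintuitionistic propositional calculus Int + A is undecidable, i.e., the set of formulas derivable in Int + A is not computable. -/

import Mathlib

namespace Paper

/-- Propositional formulas over variables indexed by ℕ, with ⊥, ∧, ∨, →. -/
inductive Fml : Type
  | var : ℕ → Fml
  | bot : Fml
  | and : Fml → Fml → Fml
  | or : Fml → Fml → Fml
  | imp : Fml → Fml → Fml

namespace Fml

/-- ¬A := A → ⊥ -/
def neg (A : Fml) : Fml := A.imp bot

/-- A ↔ B := (A → B) ∧ (B → A) -/
def biimp (A B : Fml) : Fml := (A.imp B).and (B.imp A)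

/-- The three fixed distinct variables p, q, r. -/
def p : Fml := var 0
def q : Fml := var 1
def r : Fml := var 2

/-- Applying a substitution σ to a formula. -/
def subst (σ : ℕ → Fml) : Fml → Fml
  | var n => σ n
  | bot => bot
  | and A B => and (subst σ A) (subst σ B)
  | or A B => or (subst σ A) (subst σ B)
  | imp A B => imp (subst σ A) (subst σ B)

/-- The set of variables occurring in a formula. -/
def vars : Fml → Finset ℕ
  | var n => {n}
  | bot => ∅
  | and A B => A.vars ∪ B.vars
  | or A B => A.vars ∪ B.vars
  | imp A B => A.vars ∪ B.vars

/-- An injective encoding of formulas into ℕ. -/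
def encode : Fml → ℕ
  | var n => 5 * n
  | bot => 1
  | and A B => 5 * Nat.pair A.encode B.encode + 2
  | or A B => 5 * Nat.pair A.encode B.encode + 3
  | imp A B => 5 * Nat.pair A.encode B.encode + 4

end Fml

open Fml

/-- The standard axioms of the intuitionistic propositional calculus Int. -/
def IntAx : Set Fml :=
  { p.imp (q.imp p),
    (p.imp (q.imp r)).imp ((p.imp q).imp (p.imp r)),
    (p.and q).imp p,
    (p.and q).imp q,
    p.imp (q.imp (p.and q)),
    p.imp (p.or q),
    q.imp (p.or q),
    (p.imp r).imp ((q.imp r).imp ((p.or q).imp r)),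
    (p.imp q).imp ((p.imp q.neg).imp p.neg),
    p.imp (p.neg.imp q) }

/-- Derivability in Int extended with the extra axioms Γ, with rules
    modus ponens and substitution.  `Deriv ∅ A` is `Int ⊢ A`;
    `Deriv {B} A` is `Int + B ⊢ A`. -/
inductive Deriv (Γ : Set Fml) : Fml → Prop
  | ax {A : Fml} : A ∈ IntAx → Deriv Γ A
  | extra {A : Fml} : A ∈ Γ → Deriv Γ A
  | mp {A B : Fml} : Deriv Γ (A.imp B) → Deriv Γ A → Deriv Γ B
  | subst {A : Fml} (σ : ℕ → Fml) : Deriv Γ A → Deriv Γ (A.subst σ)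

/-- (S,T) pair: `ST x n = (S_{n-2}[x], T_{n-2}[x])` (index shifted by 2). -/
def ST (x : Fml) : ℕ → Fml × Fml
  | 0 => (x.neg, x.neg.neg)
  | 1 =>
      let s := Fml.imp x.neg.neg x
      (s, s.imp (Fml.or x.neg x.neg.neg))
  | (n+2) =>
      let st1 := ST x (n+1)
      let st0 := ST x n
      let s := st1.2.imp (st1.1.or st0.2)
      (s, s.imp (st1.1.or st1.2))

def Sf (x : Fml) (n : ℕ) : Fml := (ST x n).1
def Tf (x : Fml) (n : ℕ) : Fml := (ST x n).2

/-- `A0 n = A_{n-5}^0 = S_{n-2}[r]`, `B0 n = B_{n-5}^0` (index shifted by 5). -/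
def A0 (n : ℕ) : Fml := Sf r n
def B0 (n : ℕ) : Fml := Tf r n

def C1 : Fml := A0 5
def C2 : Fml := B0 5

/-- Generic groups (A^1),(B^1) / (A^2),(B^2): `AB v c1 c2 n = (A_{n-5}, B_{n-5})`
    built over the variable `v` (index shifted by 5). -/
def AB (v c1 c2 : Fml) : ℕ → Fml × Fml
  | 0 => (Sf v 0, Tf v 0)
  | 1 => (Sf v 1, Tf v 1)
  | 2 => (Sf v 2, Tf v 2)
  | 3 =>
      let x2 := AB v c1 c2 2
      let x1 := AB v c1 c2 1
      (x2.2.imp (x2.1.or x1.2), x2.1.imp (c1.or x2.2))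
  | 4 =>
      let x3 := AB v c1 c2 3
      let x2 := AB v c1 c2 2
      (x3.2.imp (x3.1.or x2.2), x3.1.imp (x2.1.or x3.2))
  | (n+5) =>
      let x1 := AB v c1 c2 (n+4)
      let x0 := AB v c1 c2 (n+3)
      ((c2.and x1.2).imp (c1.or (x1.1.or x0.2)),
       (c2.and x1.1).imp (c1.or (x0.1.or x1.2)))

/-- `A1 n = A_{n-5}^1` etc. (index shifted by 5). -/
def A1 (n : ℕ) : Fml := (AB p C1 C2 n).1
def B1 (n : ℕ) : Fml := (AB p C1 C2 n).2
def A2 (n : ℕ) : Fml := (AB q C2 C1 n).1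
def B2 (n : ℕ) : Fml := (AB q C2 C1 n).2

/-- `AF j` is the family A^j, `BF j` the family B^j (ℕ-index shifted by 5). -/
def AF : Fin 3 → ℕ → Fml := ![A0, A1, A2]
def BF : Fin 3 → ℕ → Fml := ![B0, B1, B2]

/-- The code E_{s,m,n} of a configuration (s,m,n). -/
def Efml (s m n : ℕ) : Fml :=
  ((A0 (3*s+7)).and ((B0 (3*s+7)).and ((A1 (m+6)).and ((B1 (m+6)).and
      ((A2 (n+6)).and (B2 (n+6))))))).imp
  ((A0 (3*s+6)).or ((B0 (3*s+6)).or ((A1 (m+5)).or ((B1 (m+5)).or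
      ((A2 (n+5)).or (B2 (n+5)))))))

/-- `FG x y k = (F_k[p,q,x,y], G_k[p,q,x,y])`. -/
def FG (x y : Fml) : ℕ → Fml × Fml
  | 0 => (p, q)
  | 1 => ((y.and q).imp (x.or p), (y.and p).imp (x.or q))
  | (k+2) =>
      let fg1 := FG x y (k+1)
      let fg0 := FG x y k
      ((y.and fg1.2).imp (x.or (fg1.1.or fg0.2)),
       (y.and fg1.1).imp (x.or (fg1.2.or fg0.1)))

/-- Key formulas F_k^1, G_k^1, F_k^2, G_k^2 (as formulas in p,q,r). -/
def F1k (k : ℕ) : Fml := (FG C1 C2 k).1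
def G1k (k : ℕ) : Fml := (FG C1 C2 k).2
def F2k (k : ℕ) : Fml := (FG C2 C1 k).1
def G2k (k : ℕ) : Fml := (FG C2 C1 k).2

/-- Substituting X for p and Y for q. -/
def sub2 (X Y : Fml) (A : Fml) : Fml :=
  A.subst (fun n => if n = 0 then X else if n = 1 then Y else var n)

/-- `Pf a b = P_{a-1,b-1}` (indices shifted by 1, so defined for all a,b:ℕ, i.e. i,j ≥ -1). -/
def Pf (a b : ℕ) : Fml :=
  (C2.imp (C1.or ((A1 (a+4)).or (B1 (a+3))))).and
  (C1.imp (C2.or ((A2 (b+4)).or (B2 (b+3)))))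

/-- `Qf a b = Q_{a-1,b-1}` (indices shifted by 1). -/
def Qf (a b : ℕ) : Fml :=
  (C2.imp (C1.or ((A1 (a+3)).or (B1 (a+4))))).and
  (C1.imp (C2.or ((A2 (b+3)).or (B2 (b+4)))))

/-- Ê_{s,i,j} (intended for i,j ≥ 1). -/
def Ehat (s i j : ℕ) : Fml :=
  ((A0 (3*s+7)).and ((B0 (3*s+7)).and ((F1k (i+1)).and ((G1k (i+1)).and
      ((F2k (j+1)).and (G2k (j+1))))))).imp
  ((A0 (3*s+6)).or ((B0 (3*s+6)).or ((F1k i).or ((G1k i).or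
      ((F2k j).or (G2k j))))))

/-- Ê_{s,0,*}. -/
def Ehat0star (s : ℕ) : Fml :=
  ((A0 (3*s+7)).and ((B0 (3*s+7)).and ((A1 6).and (B1 6)))).imp
  ((A0 (3*s+6)).or ((B0 (3*s+6)).or ((A1 5).or ((B1 5).or q))))

/-- Ê_{s,*,0}. -/
def Ehatstar0 (s : ℕ) : Fml :=
  ((A0 (3*s+7)).and ((B0 (3*s+7)).and ((A2 6).and (B2 6)))).imp
  ((A0 (3*s+6)).or ((B0 (3*s+6)).or (p.or ((A2 5).or (B2 5)))))

/-! ### Minsky machines -/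

/-- Configurations (s, m, n). -/
abbrev Cfg := ℕ × ℕ × ℕ

/-- The four forms of Minsky machine instructions. -/
inductive MInstr : Type
  | inc1 (s t : ℕ)                -- s ↦ (t,1,0)
  | inc2 (s t : ℕ)                -- s ↦ (t,0,1)
  | dec1 (s t u : ℕ)              -- s ↦ (t,-1,0)/(u,0,0)
  | dec2 (s t u : ℕ)              -- s ↦ (t,0,-1)/(u,0,0)
deriving DecidableEq

def MInstr.state : MInstr → ℕ
  | inc1 s _ => s
  | inc2 s _ => s
  | dec1 s _ _ => s
  | dec2 s _ _ => s

/-- One application of an instruction to a configuration. -/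
def MInstr.step : MInstr → Cfg → Cfg → Prop
  | inc1 s t, c, c' => ∃ m n, c = (s, m, n) ∧ c' = (t, m + 1, n)
  | inc2 s t, c, c' => ∃ m n, c = (s, m, n) ∧ c' = (t, m, n + 1)
  | dec1 s t u, c, c' => ∃ m n, c = (s, m, n) ∧
      ((0 < m ∧ c' = (t, m - 1, n)) ∨ (m = 0 ∧ c' = (u, 0, n)))
  | dec2 s t u, c, c' => ∃ m n, c = (s, m, n) ∧
      ((0 < n ∧ c' = (t, m, n - 1)) ∨ (n = 0 ∧ c' = (u, m, 0)))

/-- A Minsky machine: a finite deterministic set of instructions. -/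
structure Minsky where
  instrs : List MInstr
  det : ∀ I ∈ instrs, ∀ J ∈ instrs, I.state = J.state → I = J

/-- One step of the machine. -/
def Minsky.Step (M : Minsky) (c c' : Cfg) : Prop := ∃ I ∈ M.instrs, I.step c c'

/-- (s,m,n) ⟹_𝓜 (t,k,l): reachability in finitely many (possibly zero) steps. -/
def Minsky.Reach (M : Minsky) : Cfg → Cfg → Prop := Relation.ReflTransGen M.Step

/-- The formula Ax(I) simulating an instruction I. -/
def AxI : MInstr → Fml
  | .inc1 s t => (Ehat t 2 1).imp (Ehat s 1 1)
  | .inc2 s t => (Ehat t 1 2).imp (Ehat s 1 1)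
  | .dec1 s t u => ((Ehat t 1 1).imp (Ehat s 2 1)).and ((Ehat0star u).imp (Ehat0star s))
  | .dec2 s t u => ((Ehat t 1 1).imp (Ehat s 1 2)).and ((Ehatstar0 u).imp (Ehatstar0 s))

/-- The formula Ax(𝓜): the conjunction of Ax(I) over all instructions of 𝓜. -/
def AxM (M : Minsky) : Fml := M.instrs.foldr (fun I acc => (AxI I).and acc) Fml.bot.neg

/-! ### Kripke semantics and the frame 𝔉 -/

/-- Intuitionistic forcing over an arbitrary accessibility relation R and valuation V. -/
def Force {α : Type} (R : α → α → Prop) (V : ℕ → α → Prop) : α → Fml → Prop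
  | w, Fml.var n => V n w
  | _, Fml.bot => False
  | w, Fml.and A B => Force R V w A ∧ Force R V w B
  | w, Fml.or A B => Force R V w A ∨ Force R V w B
  | w, Fml.imp A B => ∀ w', R w w' → Force R V w' A → Force R V w' B

/-- A valuation is R-upward-closed. -/
def UpClosed {α : Type} (R : α → α → Prop) (V : ℕ → α → Prop) : Prop :=
  ∀ n w w', V n w → R w w' → V n w'

/-- The equivalence ∼_𝓜: mutual reachability. -/
def MEquiv (M : Minsky) : Setoid Cfg where
  r c c' := M.Reach c c' ∧ M.Reach c' c
  iseqv := ⟨fun _ => ⟨Relation.ReflTransGen.refl, Relation.ReflTransGen.refl⟩,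
    fun h => ⟨h.2, h.1⟩, fun h h' => ⟨h.1.trans h'.1, h'.2.trans h.2⟩⟩

/-- Equivalence classes of configurations. -/
def Cl (M : Minsky) := Quotient (MEquiv M)

/-- The class [c] of a configuration c. -/
def cl (M : Minsky) (c : Cfg) : Cl M := Quotient.mk (MEquiv M) c

/-- ⟹_𝓜 lifted to equivalence classes. -/
def ClReach (M : Minsky) (α β : Cl M) : Prop :=
  ∃ c c', cl M c = α ∧ cl M c' = β ∧ M.Reach c c'

/-- Raw points: a_i^j, b_i^j (ℕ-index n = i+5, so i ≥ -5) and e_α. -/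
inductive Pt (M : Minsky) : Type
  | a (j : Fin 3) (n : ℕ)
  | b (j : Fin 3) (n : ℕ)
  | e (α : Cl M)

/-- The immediate-accessibility relation R' of the frame 𝔉 (on raw points). -/
inductive Edge (M : Minsky) (c0 : Cfg) : Pt M → Pt M → Prop
  | a4a5 (j : Fin 3) : Edge M c0 (.a j 1) (.a j 0)
  | b4a5 (j : Fin 3) : Edge M c0 (.b j 1) (.a j 0)
  | b4b5 (j : Fin 3) : Edge M c0 (.b j 1) (.b j 0)
  | a3a4 (j : Fin 3) : Edge M c0 (.a j 2) (.a j 1)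
  | a3b5 (j : Fin 3) : Edge M c0 (.a j 2) (.b j 0)
  | b3a4 (j : Fin 3) : Edge M c0 (.b j 2) (.a j 1)
  | b3b4 (j : Fin 3) : Edge M c0 (.b j 2) (.b j 1)
  -- group j = 0, i ≥ -2:
  | a0a (n : ℕ) : Edge M c0 (.a 0 (n+3)) (.a 0 (n+2))
  | a0b (n : ℕ) : Edge M c0 (.a 0 (n+3)) (.b 0 (n+1))
  | b0a (n : ℕ) : Edge M c0 (.b 0 (n+3)) (.a 0 (n+2))
  | b0b (n : ℕ) : Edge M c0 (.b 0 (n+3)) (.b 0 (n+2))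
  -- groups j = 1,2 at i = -2:
  | am2a (j : Fin 3) (h : j ≠ 0) : Edge M c0 (.a j 3) (.a j 2)
  | am2b (j : Fin 3) (h : j ≠ 0) : Edge M c0 (.a j 3) (.b j 1)
  | bm2each1 : Edge M c0 (.b 1 3) (.a 0 5)
  | bm2b1 : Edge M c0 (.b 1 3) (.b 1 2)
  | bm2each2 : Edge M c0 (.b 2 3) (.b 0 5)
  | bm2b2 : Edge M c0 (.b 2 3) (.b 2 2)
  -- groups j = 1,2, i ≥ -1:
  | aja (j : Fin 3) (h : j ≠ 0) (n : ℕ) : Edge M c0 (.a j (n+4)) (.a j (n+3))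
  | ajb (j : Fin 3) (h : j ≠ 0) (n : ℕ) : Edge M c0 (.a j (n+4)) (.b j (n+2))
  | bja (j : Fin 3) (h : j ≠ 0) (n : ℕ) : Edge M c0 (.b j (n+4)) (.a j (n+2))
  | bjb (j : Fin 3) (h : j ≠ 0) (n : ℕ) : Edge M c0 (.b j (n+4)) (.b j (n+3))
  -- group R_{s,m,n}:
  | e1 (s m n : ℕ) (h : M.Reach c0 (s,m,n)) : Edge M c0 (.e (cl M (s,m,n))) (.a 0 (3*s+6))
  | e2 (s m n : ℕ) (h : M.Reach c0 (s,m,n)) : Edge M c0 (.e (cl M (s,m,n))) (.b 0 (3*s+6))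
  | e3 (s m n : ℕ) (h : M.Reach c0 (s,m,n)) : Edge M c0 (.e (cl M (s,m,n))) (.a 1 (m+5))
  | e4 (s m n : ℕ) (h : M.Reach c0 (s,m,n)) : Edge M c0 (.e (cl M (s,m,n))) (.b 1 (m+5))
  | e5 (s m n : ℕ) (h : M.Reach c0 (s,m,n)) : Edge M c0 (.e (cl M (s,m,n))) (.a 2 (n+5))
  | e6 (s m n : ℕ) (h : M.Reach c0 (s,m,n)) : Edge M c0 (.e (cl M (s,m,n))) (.b 2 (n+5))
  -- (e_α, e_β) whenever α ⟹ β: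
  | ee (c c' : Cfg) (h : M.Reach c c') : Edge M c0 (.e (cl M c)) (.e (cl M c'))

/-- Which raw points belong to the set of worlds W. -/
def Valid (M : Minsky) (c0 : Cfg) : Pt M → Prop
  | .e α => ClReach M (cl M c0) α
  | _ => True

/-- The set of worlds W of the frame 𝔉. -/
def W (M : Minsky) (c0 : Cfg) := {x : Pt M // Valid M c0 x}

/-- The accessibility relation R of 𝔉: reflexive-transitive closure of R'. -/
def Rel (M : Minsky) (c0 : Cfg) : W M c0 → W M c0 → Prop :=
  Relation.ReflTransGen (fun x y => Edge M c0 x.1 y.1)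

/-- The point a_{n-5}^j of W. -/
def aPt (M : Minsky) (c0 : Cfg) (j : Fin 3) (n : ℕ) : W M c0 := ⟨.a j n, trivial⟩

/-- The point b_{n-5}^j of W. -/
def bPt (M : Minsky) (c0 : Cfg) (j : Fin 3) (n : ℕ) : W M c0 := ⟨.b j n, trivial⟩

/-- The point e_{[c]} of W (for a reachable configuration c). -/
def ePt (M : Minsky) (c0 : Cfg) (c : Cfg) (h : M.Reach c0 c) : W M c0 :=
  ⟨.e (cl M c), ⟨c0, c, rfl, rfl, h⟩⟩

/-- The valuation 𝔙 of the model 𝔐 (p = var 0 ↔ group 1, q = var 1 ↔ group 2,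
    r = var 2 ↔ group 0). -/
def V0 (M : Minsky) (c0 : Cfg) : ℕ → W M c0 → Prop
  | 0, w => ¬ (Rel M c0 w (aPt M c0 1 1) ∨ Rel M c0 w (bPt M c0 1 0))
  | 1, w => ¬ (Rel M c0 w (aPt M c0 2 1) ∨ Rel M c0 w (bPt M c0 2 0))
  | 2, w => ¬ (Rel M c0 w (aPt M c0 0 1) ∨ Rel M c0 w (bPt M c0 0 0))
  | _, _ => True

end Paper

namespace ThreeVar
open Paper

/-- Verum. -/
def verum : Fml := Fml.bot.neg

/-- Conjunction of a list of formulas. -/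
def conj (l : List Fml) : Fml := l.foldr Fml.and verum

/-- Disjunction of a list of formulas. -/
def disj (l : List Fml) : Fml := l.foldr Fml.or Fml.bot

/-- The two variables that carry the ladder of region `j`. -/
def dataVar : Fin 4 → Bool → ℕ
  | 0, true => 0
  | 0, false => 1
  | 1, true => 1
  | 1, false => 2
  | 2, true => 0
  | 2, false => 2
  | 3, true => 0
  | 3, false => 1

/-- The formula describing region `j`: the variable `j - 1` is refuted and the others are
doubly negated. -/
def region (j : Fin 4) : Fml :=
  conj ((List.finRange 3).map fun x : Fin 3 =>
    if x.succ = j then (Fml.var x).neg else (Fml.var x).neg.neg)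

/-- The ladder formulas of region `j`. -/
def lad (j : Fin 4) : ℕ → Bool → Fml
  | 0, s => Fml.var (dataVar j s)
  | 1, s => ((region j).and (Fml.var (dataVar j !s))).imp (Fml.var (dataVar j s))
  | n + 2, s => ((region j).and (lad j (n + 1) !s)).imp ((lad j (n + 1) s).or (lad j n !s))

/-- The sets of regions seen by the three link points. -/
def fam : Fin 3 → Fin 4 → Bool
  | 0 => ![true, true, false, false]
  | 1 => ![false, true, true, false]
  | 2 => ![false, true, true, true]

/-- The formula refuted at points seeing exactly the regions of the link `i`. -/
def linkGuard (i : Fin 3) : Fml :=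
  (conj (((List.finRange 4).filter fun j => !fam i j).map fun j => (region j).neg)).imp
    (disj (((List.finRange 4).filter fun j => fam i j).map fun j => (region j).neg))

/-- The formula refuted only when the ladder of region `j` is unshifted. -/
def zeroGuard (j : Fin 4) : Fml :=
  ((region j).and ((lad j 1 true).and (lad j 1 false))).imp ((lad j 0 true).or (lad j 0 false))

/-- The pairs consisting of a region and a side. -/
def sides : List (Fin 4 × Bool) :=
  (List.finRange 4).flatMap fun j => [(j, true), (j, false)]

/-- The formula coding the vector `c`. -/
def mainFml (c : Fin 4 → ℕ) : Fml :=
  (conj (sides.map fun t => lad t.1 (c t.1 + 3) t.2)).imp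
    (disj (sides.map fun t => lad t.1 (c t.1 + 2) t.2))

/-- A rule of a vector system: it replaces `N + src` by `N + dst`, under the condition that `N`
vanishes at the coordinates selected by `zero`; without `dst`, it accepts. -/
structure Rule where
  src : Fin 4 → ℕ
  zero : Fin 4 → Bool
  dst : Option (Fin 4 → ℕ)

/-- The vector `N` is an admissible remainder for the rule. -/
def Rule.Ok (R : Rule) (N : Fin 4 → ℕ) : Prop := ∀ j, R.zero j = true → N j = 0

/-- Acceptance in a vector system. -/
inductive Halts (P : List Rule) : (Fin 4 → ℕ) → Prop
  | accept {R : Rule} (hR : R ∈ P) (hd : R.dst = none) (N : Fin 4 → ℕ) (hN : R.Ok N) :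
      Halts P (N + R.src)
  | step {R : Rule} (hR : R ∈ P) (d : Fin 4 → ℕ) (hd : R.dst = some d) (N : Fin 4 → ℕ)
      (hN : R.Ok N) (h : Halts P (N + d)) : Halts P (N + R.src)

/-- The disjunction of the link guards. -/
def linkGuards : Fml := disj ((List.finRange 3).map linkGuard)

/-- The disjunction of the zero guards of the coordinates selected by `z`. -/
def zeroGuards (z : Fin 4 → Bool) : Fml :=
  disj (((List.finRange 4).filter fun j => z j).map zeroGuard)

/-- The conclusion of the formula of a rule. -/
def goalFml (z : Fin 4 → Bool) (c : Fin 4 → ℕ) : Fml :=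
  linkGuards.or ((zeroGuards z).or (mainFml c))

/-- The formula of a rule. -/
def Rule.fml (R : Rule) : Fml :=
  match R.dst with
  | none => goalFml R.zero R.src
  | some d => (mainFml d).imp (goalFml R.zero R.src)

/-- The axiom of a vector system. -/
def axiomFml (P : List Rule) : Fml := conj (P.map Rule.fml)

/-- The formula expressing acceptance of `c`. -/
def acceptFml (c : Fin 4 → ℕ) : Fml := goalFml (fun _ => true) c

/-! ### Variables -/

theorem vars_conj {l : List Fml} {S : Finset ℕ} (h : ∀ A ∈ l, A.vars ⊆ S) :
    (conj l).vars ⊆ S := by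
  induction l with
  | nil => simp [conj, verum, Fml.neg, Fml.vars]
  | cons a l ih =>
    simp only [conj, List.foldr_cons, Fml.vars]
    exact Finset.union_subset (h a (by simp)) (ih fun A hA => h A (by simp [hA]))

theorem vars_disj {l : List Fml} {S : Finset ℕ} (h : ∀ A ∈ l, A.vars ⊆ S) :
    (disj l).vars ⊆ S := by
  induction l with
  | nil => simp [disj, Fml.vars]
  | cons a l ih =>
    simp only [disj, List.foldr_cons, Fml.vars]
    exact Finset.union_subset (h a (by simp)) (ih fun A hA => h A (by simp [hA]))

theorem vars_imp {A B : Fml} {S : Finset ℕ} (hA : A.vars ⊆ S) (hB : B.vars ⊆ S) :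
    (A.imp B).vars ⊆ S := Finset.union_subset hA hB

theorem vars_and {A B : Fml} {S : Finset ℕ} (hA : A.vars ⊆ S) (hB : B.vars ⊆ S) :
    (A.and B).vars ⊆ S := Finset.union_subset hA hB

theorem vars_or {A B : Fml} {S : Finset ℕ} (hA : A.vars ⊆ S) (hB : B.vars ⊆ S) :
    (A.or B).vars ⊆ S := Finset.union_subset hA hB

theorem vars_neg {A : Fml} {S : Finset ℕ} (hA : A.vars ⊆ S) : A.neg.vars ⊆ S :=
  vars_imp hA (Finset.empty_subset _)

theorem dataVar_mem (j : Fin 4) (s : Bool) : dataVar j s ∈ ({0, 1, 2} : Finset ℕ) := by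
  revert j s; decide

theorem vars_data (j : Fin 4) (s : Bool) :
    (Fml.var (dataVar j s)).vars ⊆ ({0, 1, 2} : Finset ℕ) :=
  Finset.singleton_subset_iff.2 (dataVar_mem j s)

theorem vars_region (j : Fin 4) : (region j).vars ⊆ ({0, 1, 2} : Finset ℕ) := by
  revert j; decide

theorem vars_lad (j : Fin 4) (n : ℕ) : ∀ s, (lad j n s).vars ⊆ ({0, 1, 2} : Finset ℕ) := by
  induction n using Nat.strong_induction_on with
  | _ n ih =>
    intro s
    match n, ih with
    | 0, _ => exact vars_data j s
    | 1, _ => exact vars_imp (vars_and (vars_region j) (vars_data j _)) (vars_data j s)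
    | n + 2, ih =>
      exact vars_imp (vars_and (vars_region j) (ih _ (by omega) _))
        (vars_or (ih _ (by omega) _) (ih _ (by omega) _))

theorem vars_mainFml (c : Fin 4 → ℕ) : (mainFml c).vars ⊆ ({0, 1, 2} : Finset ℕ) := by
  refine vars_imp (vars_conj fun A hA => ?_) (vars_disj fun A hA => ?_) <;>
  · obtain ⟨t, -, rfl⟩ := List.mem_map.1 hA
    exact vars_lad _ _ _

theorem vars_goalFml (z : Fin 4 → Bool) (c : Fin 4 → ℕ) :
    (goalFml z c).vars ⊆ ({0, 1, 2} : Finset ℕ) := by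
  refine vars_or (vars_disj fun A hA => ?_) (vars_or (vars_disj fun A hA => ?_) (vars_mainFml c))
  · obtain ⟨i, -, rfl⟩ := List.mem_map.1 hA
    refine vars_imp (vars_conj fun A hA => ?_) (vars_disj fun A hA => ?_) <;>
    · obtain ⟨t, -, rfl⟩ := List.mem_map.1 hA
      exact vars_neg (vars_region _)
  · obtain ⟨j, -, rfl⟩ := List.mem_map.1 hA
    exact vars_imp (vars_and (vars_region j) (vars_and (vars_lad _ _ _) (vars_lad _ _ _)))
      (vars_or (vars_lad _ _ _) (vars_lad _ _ _))

theorem vars_axiomFml (P : List Rule) : (axiomFml P).vars ⊆ ({0, 1, 2} : Finset ℕ) := by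
  refine vars_conj fun A hA => ?_
  obtain ⟨R, -, rfl⟩ := List.mem_map.1 hA
  unfold Rule.fml
  split
  · exact vars_goalFml _ _
  · exact vars_imp (vars_mainFml _) (vars_goalFml _ _)

end ThreeVar

namespace ThreeVar
open Paper

/-! ### Algebraic semantics -/

section Algebra

variable {H : Type*} [HeytingAlgebra H]

/-- The value of a formula in a Heyting algebra. -/
def eval (v : ℕ → H) : Fml → H
  | .var n => v n
  | .bot => ⊥
  | .and A B => eval v A ⊓ eval v B
  | .or A B => eval v A ⊔ eval v B
  | .imp A B => eval v A ⇨ eval v B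

theorem eval_neg (v : ℕ → H) (A : Fml) : eval v A.neg = (eval v A)ᶜ := by
  simp [Fml.neg, eval]

theorem eval_verum (v : ℕ → H) : eval v verum = ⊤ := by simp [verum, Fml.neg, eval]

theorem le_eval_conj {v : ℕ → H} {l : List Fml} {x : H} :
    x ≤ eval v (conj l) ↔ ∀ A ∈ l, x ≤ eval v A := by
  induction l with
  | nil => simp [conj, eval_verum]
  | cons a l ih => simpa [conj, eval] using fun _ => ih

theorem eval_disj_le {v : ℕ → H} {l : List Fml} {x : H} :
    eval v (disj l) ≤ x ↔ ∀ A ∈ l, eval v A ≤ x := by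
  induction l with
  | nil => simp [disj, eval]
  | cons a l ih => simpa [disj, eval] using fun _ => ih

theorem eval_conj_congr {α : Type*} {v w : ℕ → H} {l : List α} {f g : α → Fml}
    (h : ∀ a ∈ l, eval v (f a) = eval w (g a)) :
    eval v (conj (l.map f)) = eval w (conj (l.map g)) := by
  induction l with
  | nil => simp [conj, eval_verum]
  | cons a l ih =>
    simp only [List.map_cons, conj, List.foldr_cons, eval]
    exact congrArg₂ _ (h a (by simp)) (ih fun b hb => h b (by simp [hb]))

theorem eval_disj_congr {α : Type*} {v w : ℕ → H} {l : List α} {f g : α → Fml}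
    (h : ∀ a ∈ l, eval v (f a) = eval w (g a)) :
    eval v (disj (l.map f)) = eval w (disj (l.map g)) := by
  induction l with
  | nil => simp [disj, eval]
  | cons a l ih =>
    simp only [List.map_cons, disj, List.foldr_cons, eval]
    exact congrArg₂ _ (h a (by simp)) (ih fun b hb => h b (by simp [hb]))

theorem dataVar_injective {j : Fin 4} {s t : Bool} (h : dataVar j s = dataVar j t) : s = t := by
  revert j s t; decide

theorem le_eval_region {v : ℕ → H} {j : Fin 4} {x : H} :
    x ≤ eval v (region j) ↔
      ∀ k : Fin 3, x ≤ if k.succ = j then (v k)ᶜ else (v k)ᶜᶜ := by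
  have : ∀ k : Fin 3, eval v (if k.succ = j then (Fml.var k).neg else (Fml.var k).neg.neg) =
      if k.succ = j then (v k)ᶜ else (v k)ᶜᶜ := by
    intro k
    split <;> simp [eval_neg, eval]
  simp [region, le_eval_conj, this]

theorem region_le {v : ℕ → H} (j : Fin 4) (k : Fin 3) :
    eval v (region j) ≤ if k.succ = j then (v k)ᶜ else (v k)ᶜᶜ :=
  le_eval_region.1 le_rfl k

theorem region_disjoint (v : ℕ → H) {i j : Fin 4} (h : i ≠ j) :
    eval v (region i) ⊓ eval v (region j) = ⊥ := by
  have key : ∀ k : Fin 3, (k.succ = i ∧ k.succ ≠ j) ∨ (k.succ ≠ i ∧ k.succ = j) →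
      eval v (region i) ⊓ eval v (region j) = ⊥ := by
    intro k hk
    have hi := region_le (v := v) i k
    have hj := region_le (v := v) j k
    rcases hk with ⟨h1, h2⟩ | ⟨h1, h2⟩
    · rw [if_pos h1] at hi
      rw [if_neg h2] at hj
      exact le_bot_iff.1 ((inf_le_inf hi hj).trans_eq (by simp))
    · rw [if_neg h1] at hi
      rw [if_pos h2] at hj
      exact le_bot_iff.1 ((inf_le_inf hi hj).trans_eq (by simp))
  have : ∃ k : Fin 3, (k.succ = i ∧ k.succ ≠ j) ∨ (k.succ ≠ i ∧ k.succ = j) := by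
    clear key; revert i j; decide
  exact this.elim key

theorem region_le_data (v : ℕ → H) (j : Fin 4) (s : Bool) :
    eval v (region j) ≤ (v (dataVar j s))ᶜᶜ := by
  have : ∃ k : Fin 3, (k : ℕ) = dataVar j s ∧ k.succ ≠ j := by revert j s; decide
  obtain ⟨k, hk, hkj⟩ := this
  simpa [hkj, hk] using region_le (v := v) j k

/-- The ladder over two elements, relative to the element `ρ`. -/
def ladder (ρ : H) (a : Bool → H) : ℕ → Bool → H
  | 0, s => a s
  | 1, s => ρ ⊓ a (!s) ⇨ a s
  | n + 2, s => ρ ⊓ ladder ρ a (n + 1) (!s) ⇨ ladder ρ a (n + 1) s ⊔ ladder ρ a n (!s)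

theorem eval_lad (v : ℕ → H) (j : Fin 4) (n : ℕ) (s : Bool) :
    eval v (lad j n s) = ladder (eval v (region j)) (fun s => v (dataVar j s)) n s := by
  induction n using Nat.strong_induction_on generalizing s with
  | _ n ih =>
    match n, ih with
    | 0, _ => rfl
    | 1, _ => rfl
    | n + 2, ih =>
      simp only [lad, eval, ladder]
      rw [ih _ (by omega), ih _ (by omega), ih _ (by omega)]

theorem ladder_le_succ (ρ : H) (a : Bool → H) (n : ℕ) (s : Bool) :
    ladder ρ a n s ≤ ladder ρ a (n + 1) s := by
  cases n with
  | zero => exact le_himp_iff.2 inf_le_left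
  | succ n => exact le_himp_iff.2 (inf_le_left.trans le_sup_left)

/-- The pair of elements at which the ladder starts when it is shifted by `N`. -/
def shiftData (ρ : H) (a : Bool → H) : ℕ → Bool → H
  | 0, s => a s
  | N + 1, s => ladder ρ a (N + 1) s ⊔ ladder ρ a N (!s)

theorem le_shiftData (ρ : H) (a : Bool → H) (N : ℕ) (s : Bool) : a s ≤ shiftData ρ a N s := by
  cases N with
  | zero => exact le_rfl
  | succ N =>
    refine le_trans ?_ le_sup_left
    induction N with
    | zero => exact ladder_le_succ ρ a 0 s
    | succ N ih => exact ih.trans (ladder_le_succ ρ a _ s)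

theorem himp_congr_of_inf {ρ x x' y y' : H} (hx : ρ ⊓ x = ρ ⊓ x') (hy : ρ ⊓ y = ρ ⊓ y') :
    ρ ⊓ x ⇨ y = ρ ⊓ x' ⇨ y' := by
  have key : ∀ {x x' y y' : H}, ρ ⊓ x = ρ ⊓ x' → ρ ⊓ y = ρ ⊓ y' →
      ρ ⊓ x ⇨ y ≤ ρ ⊓ x' ⇨ y' := by
    intro x x' y y' hx hy
    rw [le_himp_iff, ← hx]
    have h1 : (ρ ⊓ x ⇨ y) ⊓ (ρ ⊓ x) ≤ y := himp_inf_le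
    have h2 : (ρ ⊓ x ⇨ y) ⊓ (ρ ⊓ x) ≤ ρ ⊓ y :=
      le_inf (inf_le_right.trans inf_le_left) h1
    exact (h2.trans_eq hy).trans inf_le_right
  exact le_antisymm (key hx hy) (key hx.symm hy.symm)

theorem ladder_shift {ρ : H} {a b : Bool → H} {N : ℕ}
    (h : ∀ s, ρ ⊓ b s = ρ ⊓ shiftData ρ a N s) (i : ℕ) (s : Bool) :
    ladder ρ b (i + 1) s = ladder ρ a (N + i + 1) s := by
  induction i using Nat.strong_induction_on generalizing s with
  | _ i ih =>
    match i, ih with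
    | 0, _ =>
      simp only [ladder]
      rw [himp_congr_of_inf (h _) (h _)]
      cases N with
      | zero => rfl
      | succ N =>
        simp only [shiftData, Bool.not_not, ladder]
        refine le_antisymm (himp_le_himp_right (inf_le_inf_left _ le_sup_left)) ?_
        rw [le_himp_iff, inf_sup_left, inf_sup_left]
        exact sup_le himp_inf_le (inf_le_right.trans
          (inf_le_right.trans ((ladder_le_succ ρ a N s).trans le_sup_left)))
    | 1, ih =>
      have e := ih 0 (by omega)
      simp only [ladder, Nat.add_zero] at e ⊢
      have e' : ∀ s, (ρ ⊓ b (!s) ⇨ b s) = ladder ρ a (N + 1) s := e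
      rw [e', e']
      refine himp_congr_of_inf rfl ?_
      rw [inf_sup_left, h, ← inf_sup_left]
      cases N with
      | zero => rfl
      | succ N =>
        simp only [shiftData, Bool.not_not]
        congr 1
        refine le_antisymm (sup_le le_sup_left (sup_le le_sup_right ?_))
          (sup_le_sup_left le_sup_left _)
        exact (ladder_le_succ ρ a N s).trans ((ladder_le_succ ρ a _ s).trans le_sup_left)
    | i + 2, ih =>
      have e1 := ih (i + 1) (by omega)
      have e0 := ih i (by omega)
      rw [ladder, e1, e1, e0]
      rfl

/-- The valuation in which the ladder of each region `j` is shifted by `N j`. -/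
def shift (v : ℕ → H) (N : Fin 4 → ℕ) (x : ℕ) : H :=
  v x ⊔ Finset.univ.sup fun t : Fin 4 × Bool =>
    if dataVar t.1 t.2 = x then
      eval v (region t.1) ⊓
        shiftData (eval v (region t.1)) (fun s => v (dataVar t.1 s)) (N t.1) t.2
    else ⊥

theorem le_shift (v : ℕ → H) (N : Fin 4 → ℕ) (x : ℕ) : v x ≤ shift v N x := le_sup_left

theorem shift_le (v : ℕ → H) (N : Fin 4 → ℕ) (x : ℕ) : shift v N x ≤ (v x)ᶜᶜ := by
  refine sup_le le_compl_compl (Finset.sup_le fun t _ => ?_)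
  split
  · next h => exact inf_le_left.trans (h ▸ region_le_data v t.1 t.2)
  · exact bot_le

theorem shift_compl (v : ℕ → H) (N : Fin 4 → ℕ) (x : ℕ) : (shift v N x)ᶜ = (v x)ᶜ :=
  le_antisymm (compl_le_compl (le_shift v N x))
    ((compl_le_compl (shift_le v N x)).trans' (by simp))

theorem eval_shift_region (v : ℕ → H) (N : Fin 4 → ℕ) (j : Fin 4) :
    eval (shift v N) (region j) = eval v (region j) := by
  have key : ∀ x, x ≤ eval (shift v N) (region j) ↔ x ≤ eval v (region j) := by
    intro x
    simp only [le_eval_region, shift_compl]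
  exact le_antisymm ((key _).1 le_rfl) ((key _).2 le_rfl)

theorem region_inf_shift (v : ℕ → H) (N : Fin 4 → ℕ) (j : Fin 4) (s : Bool) :
    eval v (region j) ⊓ shift v N (dataVar j s) = eval v (region j) ⊓
      shiftData (eval v (region j)) (fun s => v (dataVar j s)) (N j) s := by
  apply le_antisymm
  · rw [shift, inf_sup_left]
    refine sup_le (inf_le_inf_left _ (le_shiftData _ (fun s => v (dataVar j s)) _ _)) ?_
    rw [Finset.sup_inf_distrib_left]
    refine Finset.sup_le fun t _ => ?_
    split
    · next h =>
      by_cases hj : t.1 = j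
      · obtain ⟨i, s'⟩ := t
        subst hj
        cases dataVar_injective h
        exact inf_le_right
      · rw [← inf_assoc, inf_comm (eval v (region j)), region_disjoint v hj, bot_inf_eq]
        exact bot_le
    · simp
  · refine le_inf inf_le_left (le_sup_of_le_right ?_)
    refine le_trans ?_ (Finset.le_sup (Finset.mem_univ (j, s)))
    simp

theorem eval_shift_lad (v : ℕ → H) (N : Fin 4 → ℕ) (j : Fin 4) (i : ℕ) (s : Bool) :
    eval (shift v N) (lad j (i + 1) s) = eval v (lad j (N j + i + 1) s) := by
  rw [eval_lad, eval_lad, eval_shift_region]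
  exact ladder_shift (region_inf_shift v N j) i s

theorem eval_shift_mainFml (v : ℕ → H) (N c : Fin 4 → ℕ) :
    eval (shift v N) (mainFml c) = eval v (mainFml (N + c)) := by
  simp only [mainFml, eval]
  congr 1
  · exact eval_conj_congr fun t _ => by
      rw [eval_shift_lad v N t.1 (c t.1 + 2) t.2]; simp only [Pi.add_apply, add_assoc]
  · exact eval_disj_congr fun t _ => by
      rw [eval_shift_lad v N t.1 (c t.1 + 1) t.2]; simp only [Pi.add_apply, add_assoc]

theorem eval_shift_linkGuards (v : ℕ → H) (N : Fin 4 → ℕ) :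
    eval (shift v N) linkGuards = eval v linkGuards := by
  refine eval_disj_congr fun i _ => ?_
  simp only [linkGuard, eval]
  congr 1
  · exact eval_conj_congr fun j _ => by rw [eval_neg, eval_neg, eval_shift_region]
  · exact eval_disj_congr fun j _ => by rw [eval_neg, eval_neg, eval_shift_region]

theorem eval_shift_zeroGuard (v : ℕ → H) (N : Fin 4 → ℕ) {j : Fin 4} (h : N j = 0) :
    eval (shift v N) (zeroGuard j) = eval v (zeroGuard j) := by
  simp only [zeroGuard, eval, eval_shift_lad v N j 0, eval_shift_region, h]
  refine himp_congr_of_inf rfl ?_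
  simp only [lad, eval, inf_sup_left, region_inf_shift, h, shiftData]

theorem eval_zeroGuards_le (v : ℕ → H) (z : Fin 4 → Bool) :
    eval v (zeroGuards z) ≤ eval v (zeroGuards fun _ => true) := by
  refine eval_disj_le.2 fun A hA => ?_
  obtain ⟨j, -, rfl⟩ := List.mem_map.1 hA
  exact eval_disj_le.1 le_rfl _ (List.mem_map.2 ⟨j, by simp, rfl⟩)

theorem eval_shift_goalFml (v : ℕ → H) {N : Fin 4 → ℕ} (c : Fin 4 → ℕ) {z : Fin 4 → Bool}
    (hN : ∀ j, z j = true → N j = 0) :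
    eval (shift v N) (goalFml z c) ≤ eval v (acceptFml (N + c)) := by
  simp only [acceptFml, goalFml, eval, eval_shift_linkGuards, eval_shift_mainFml]
  refine sup_le_sup_left (sup_le_sup_right (le_trans ?_ (eval_zeroGuards_le v z)) _) _
  refine (eval_disj_congr fun j hj => ?_).le
  exact eval_shift_zeroGuard v N (hN j (by simpa using hj))

theorem eval_acceptFml_of_halts {P : List Rule} (hP : ∀ v : ℕ → H, eval v (axiomFml P) = ⊤)
    {c : Fin 4 → ℕ} (h : Halts P c) (v : ℕ → H) : eval v (acceptFml c) = ⊤ := by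
  have hR : ∀ R ∈ P, ∀ v : ℕ → H, eval v R.fml = ⊤ := fun R hR v =>
    top_le_iff.1 (le_eval_conj.1 (hP v).ge _ (List.mem_map.2 ⟨R, hR, rfl⟩))
  induction h with
  | @accept R hRP hd N hN =>
    have := hR R hRP (shift v N)
    simp only [Rule.fml, hd] at this
    exact top_le_iff.1 (this.ge.trans (eval_shift_goalFml v R.src hN))
  | @step R hRP d hd N hN _ ih =>
    have := hR R hRP (shift v N)
    simp only [Rule.fml, hd, eval, himp_eq_top_iff] at this
    rw [eval_shift_mainFml] at this
    have := this.trans (eval_shift_goalFml v R.src hN)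
    rw [← top_le_iff, ← ih]
    simp only [acceptFml, goalFml, eval] at this ⊢
    exact sup_le le_sup_left (sup_le (le_sup_left.trans le_sup_right) this)

end Algebra

/-! ### The Lindenbaum algebra -/

section Lindenbaum

variable {Γ : Set Fml}

/-- The substitution for the variables of the axiom schemes. -/
def subst3 (A B C : Fml) : ℕ → Fml
  | 0 => A
  | 1 => B
  | _ => C

theorem deriv_ax {X : Fml} (h : X ∈ IntAx) (A B C : Fml) : Deriv Γ (X.subst (subst3 A B C)) :=
  .subst _ (.ax h)

theorem deriv_k (A B : Fml) : Deriv Γ (A.imp (B.imp A)) :=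
  deriv_ax (X := Fml.p.imp (Fml.q.imp Fml.p)) (by simp [IntAx]) A B A

theorem deriv_s (A B C : Fml) :
    Deriv Γ ((A.imp (B.imp C)).imp ((A.imp B).imp (A.imp C))) :=
  deriv_ax (X := (Fml.p.imp (Fml.q.imp Fml.r)).imp ((Fml.p.imp Fml.q).imp (Fml.p.imp Fml.r)))
    (by simp [IntAx]) A B C

theorem deriv_fst (A B : Fml) : Deriv Γ ((A.and B).imp A) :=
  deriv_ax (X := (Fml.p.and Fml.q).imp Fml.p) (by simp [IntAx]) A B A

theorem deriv_snd (A B : Fml) : Deriv Γ ((A.and B).imp B) :=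
  deriv_ax (X := (Fml.p.and Fml.q).imp Fml.q) (by simp [IntAx]) A B A

theorem deriv_pair (A B : Fml) : Deriv Γ (A.imp (B.imp (A.and B))) :=
  deriv_ax (X := Fml.p.imp (Fml.q.imp (Fml.p.and Fml.q))) (by simp [IntAx]) A B A

theorem deriv_inl (A B : Fml) : Deriv Γ (A.imp (A.or B)) :=
  deriv_ax (X := Fml.p.imp (Fml.p.or Fml.q)) (by simp [IntAx]) A B A

theorem deriv_inr (A B : Fml) : Deriv Γ (B.imp (A.or B)) :=
  deriv_ax (X := Fml.q.imp (Fml.p.or Fml.q)) (by simp [IntAx]) A B A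

theorem deriv_cases (A B C : Fml) :
    Deriv Γ ((A.imp C).imp ((B.imp C).imp ((A.or B).imp C))) :=
  deriv_ax (X := (Fml.p.imp Fml.r).imp ((Fml.q.imp Fml.r).imp ((Fml.p.or Fml.q).imp Fml.r)))
    (by simp [IntAx]) A B C

theorem deriv_id (A : Fml) : Deriv Γ (A.imp A) :=
  .mp (.mp (deriv_s A (A.imp A) A) (deriv_k A (A.imp A))) (deriv_k A A)

theorem deriv_weaken {B : Fml} (A : Fml) (h : Deriv Γ B) : Deriv Γ (A.imp B) :=
  .mp (deriv_k B A) h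

theorem deriv_trans {A B C : Fml} (h₁ : Deriv Γ (A.imp B)) (h₂ : Deriv Γ (B.imp C)) :
    Deriv Γ (A.imp C) :=
  .mp (.mp (deriv_s A B C) (deriv_weaken A h₂)) h₁

theorem deriv_app {A B C : Fml} (h₁ : Deriv Γ (A.imp (B.imp C))) (h₂ : Deriv Γ (A.imp B)) :
    Deriv Γ (A.imp C) :=
  .mp (.mp (deriv_s A B C) h₁) h₂

theorem deriv_le_and {A B C : Fml} (h₁ : Deriv Γ (A.imp B)) (h₂ : Deriv Γ (A.imp C)) :
    Deriv Γ (A.imp (B.and C)) :=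
  deriv_app (deriv_trans h₁ (deriv_pair B C)) h₂

theorem deriv_or_le {A B C : Fml} (h₁ : Deriv Γ (A.imp C)) (h₂ : Deriv Γ (B.imp C)) :
    Deriv Γ ((A.or B).imp C) :=
  .mp (.mp (deriv_cases A B C) h₁) h₂

theorem deriv_curry {A B C : Fml} (h : Deriv Γ ((A.and B).imp C)) :
    Deriv Γ (A.imp (B.imp C)) :=
  deriv_app (deriv_trans (deriv_weaken A (deriv_weaken B h)) (deriv_s B (A.and B) C))
    (deriv_pair A B)

theorem deriv_uncurry {A B C : Fml} (h : Deriv Γ (A.imp (B.imp C))) :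
    Deriv Γ ((A.and B).imp C) :=
  deriv_app (deriv_trans (deriv_fst A B) h) (deriv_snd A B)

theorem deriv_bot (A : Fml) : Deriv Γ (Fml.bot.imp A) := by
  have efq : Deriv Γ (Fml.bot.imp (Fml.bot.neg.imp A)) :=
    deriv_ax (X := Fml.p.imp (Fml.p.neg.imp Fml.q)) (by simp [IntAx]) Fml.bot A A
  exact deriv_app efq (deriv_weaken _ (deriv_id _))

variable (Γ) in
/-- Provable implication as a preorder. -/
def Thm : Type := (fun (_ : Set Fml) => Fml) Γ

instance : Preorder (Thm Γ) where
  le A B := Deriv Γ (Fml.imp A B)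
  le_refl := deriv_id
  le_trans _ _ _ := deriv_trans

variable (Γ) in
/-- The Lindenbaum algebra of a calculus. -/
abbrev Lind : Type := Antisymmetrization (Thm Γ) (· ≤ ·)

variable (Γ) in
/-- The class of a formula in the Lindenbaum algebra. -/
def cls (A : Fml) : Lind Γ := toAntisymmetrization (α := Thm Γ) (· ≤ ·) A

theorem cls_le {A B : Fml} : cls Γ A ≤ cls Γ B ↔ Deriv Γ (A.imp B) := Iff.rfl

theorem cls_eq {A B : Fml} (h₁ : Deriv Γ (A.imp B)) (h₂ : Deriv Γ (B.imp A)) :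
    cls Γ A = cls Γ B := le_antisymm (cls_le.2 h₁) (cls_le.2 h₂)

theorem cls_surjective (x : Lind Γ) : ∃ A, cls Γ A = x := by
  induction x using Quotient.inductionOn with
  | _ A => exact ⟨A, rfl⟩

/-- A binary connective that respects provable equivalence, as an operation of the algebra. -/
noncomputable def lift₂ (f : Fml → Fml → Fml) (x y : Lind Γ) : Lind Γ :=
  cls Γ (f (cls_surjective x).choose (cls_surjective y).choose)

theorem lift₂_cls {f : Fml → Fml → Fml}
    (hf : ∀ {A A' B B' : Fml}, Deriv Γ (A.imp A') → Deriv Γ (A'.imp A) →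
      Deriv Γ (B.imp B') → Deriv Γ (B'.imp B) → Deriv Γ ((f A B).imp (f A' B'))) (A B : Fml) :
    lift₂ f (cls Γ A) (cls Γ B) = cls Γ (f A B) := by
  have hA := (cls_surjective (cls Γ A)).choose_spec
  have hB := (cls_surjective (cls Γ B)).choose_spec
  exact cls_eq (hf (cls_le.1 hA.le) (cls_le.1 hA.ge) (cls_le.1 hB.le) (cls_le.1 hB.ge))
    (hf (cls_le.1 hA.ge) (cls_le.1 hA.le) (cls_le.1 hB.ge) (cls_le.1 hB.le))

theorem lift_and (A B : Fml) : lift₂ Fml.and (cls Γ A) (cls Γ B) = cls Γ (A.and B) :=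
  lift₂_cls (fun h₁ _ h₃ _ => deriv_le_and (deriv_trans (deriv_fst _ _) h₁)
    (deriv_trans (deriv_snd _ _) h₃)) A B

theorem lift_or (A B : Fml) : lift₂ Fml.or (cls Γ A) (cls Γ B) = cls Γ (A.or B) :=
  lift₂_cls (fun h₁ _ h₃ _ => deriv_or_le (deriv_trans h₁ (deriv_inl _ _))
    (deriv_trans h₃ (deriv_inr _ _))) A B

theorem lift_imp (A B : Fml) : lift₂ Fml.imp (cls Γ A) (cls Γ B) = cls Γ (A.imp B) :=
  lift₂_cls (fun _ h₂ h₃ _ => deriv_curry (deriv_trans (deriv_app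
    (deriv_fst _ _) (deriv_trans (deriv_snd _ _) h₂)) h₃)) A B

noncomputable instance : HeytingAlgebra (Lind Γ) where
  sup := lift₂ Fml.or
  inf := lift₂ Fml.and
  himp := lift₂ Fml.imp
  compl x := lift₂ Fml.imp x (cls Γ Fml.bot)
  top := cls Γ verum
  bot := cls Γ Fml.bot
  le_top x := by
    obtain ⟨A, rfl⟩ := cls_surjective x
    exact deriv_weaken A (deriv_id _)
  bot_le x := by
    obtain ⟨A, rfl⟩ := cls_surjective x
    exact deriv_bot A
  le_sup_left x y := by
    obtain ⟨A, rfl⟩ := cls_surjective x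
    obtain ⟨B, rfl⟩ := cls_surjective y
    rw [lift_or]; exact deriv_inl A B
  le_sup_right x y := by
    obtain ⟨A, rfl⟩ := cls_surjective x
    obtain ⟨B, rfl⟩ := cls_surjective y
    rw [lift_or]; exact deriv_inr A B
  sup_le x y z h₁ h₂ := by
    obtain ⟨A, rfl⟩ := cls_surjective x
    obtain ⟨B, rfl⟩ := cls_surjective y
    obtain ⟨C, rfl⟩ := cls_surjective z
    rw [lift_or]; exact deriv_or_le h₁ h₂
  inf_le_left x y := by
    obtain ⟨A, rfl⟩ := cls_surjective x
    obtain ⟨B, rfl⟩ := cls_surjective y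
    rw [lift_and]; exact deriv_fst A B
  inf_le_right x y := by
    obtain ⟨A, rfl⟩ := cls_surjective x
    obtain ⟨B, rfl⟩ := cls_surjective y
    rw [lift_and]; exact deriv_snd A B
  le_inf x y z h₁ h₂ := by
    obtain ⟨A, rfl⟩ := cls_surjective x
    obtain ⟨B, rfl⟩ := cls_surjective y
    obtain ⟨C, rfl⟩ := cls_surjective z
    rw [lift_and]; exact deriv_le_and h₁ h₂
  le_himp_iff x y z := by
    obtain ⟨A, rfl⟩ := cls_surjective x
    obtain ⟨B, rfl⟩ := cls_surjective y
    obtain ⟨C, rfl⟩ := cls_surjective z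
    rw [lift_imp]
    change _ ↔ lift₂ Fml.and _ _ ≤ _
    rw [lift_and]
    exact ⟨deriv_uncurry, deriv_curry⟩
  himp_bot _ := rfl

theorem eval_cls (σ : ℕ → Fml) (A : Fml) :
    eval (fun n => cls Γ (σ n)) A = cls Γ (A.subst σ) := by
  induction A with
  | var n => rfl
  | bot => rfl
  | and A B hA hB => rw [eval, hA, hB]; exact lift_and _ _
  | or A B hA hB => rw [eval, hA, hB]; exact lift_or _ _
  | imp A B hA hB => rw [eval, hA, hB]; exact lift_imp _ _

theorem cls_eq_top {A : Fml} : cls Γ A = ⊤ ↔ Deriv Γ A :=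
  ⟨fun h => .mp (cls_le.1 h.ge) (deriv_id _),
    fun h => le_antisymm le_top (cls_le.2 (deriv_weaken _ h))⟩

theorem subst_var (A : Fml) : A.subst Fml.var = A := by
  induction A with
  | var n => rfl
  | bot => rfl
  | and A B hA hB => rw [Fml.subst, hA, hB]
  | or A B hA hB => rw [Fml.subst, hA, hB]
  | imp A B hA hB => rw [Fml.subst, hA, hB]

theorem deriv_of_halts {P : List Rule} {c : Fin 4 → ℕ} (h : Halts P c) :
    Deriv {axiomFml P} (acceptFml c) := by
  have hP : ∀ v : ℕ → Lind {axiomFml P}, eval v (axiomFml P) = ⊤ := by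
    intro v
    obtain ⟨σ, rfl⟩ : ∃ σ : ℕ → Fml, (fun n => cls {axiomFml P} (σ n)) = v :=
      ⟨fun n => (cls_surjective (v n)).choose,
        funext fun n => (cls_surjective (v n)).choose_spec⟩
    rw [eval_cls, cls_eq_top]
    exact .subst σ (.extra rfl)
  have := eval_acceptFml_of_halts hP h fun n => cls _ (Fml.var n)
  rwa [eval_cls, cls_eq_top, subst_var] at this

end Lindenbaum

end ThreeVar

namespace ThreeVar
open Paper

/-! ### Kripke semantics -/

section Kripke

variable {α : Type} {R : α → α → Prop}

theorem force_mono (htrans : ∀ x y z, R x y → R y z → R x z) {V : ℕ → α → Prop}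
    (hV : UpClosed R V) {A : Fml} {w w' : α} (hw : R w w') (h : Force R V w A) :
    Force R V w' A := by
  induction A generalizing w w' with
  | var n => exact hV n w w' h hw
  | bot => exact h
  | and A B hA hB => exact ⟨hA hw h.1, hB hw h.2⟩
  | or A B hA hB => exact h.imp (hA hw) (hB hw)
  | imp A B hA hB => exact fun u hu => h u (htrans _ _ _ hw hu)

theorem force_subst {V : ℕ → α → Prop} {σ : ℕ → Fml} {A : Fml} {w : α} :
    Force R V w (A.subst σ) ↔ Force R (fun n w => Force R V w (σ n)) w A := by
  induction A generalizing w with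
  | var n => rfl
  | bot => rfl
  | and A B hA hB => simp only [Fml.subst, Force, hA, hB]
  | or A B hA hB => simp only [Fml.subst, Force, hA, hB]
  | imp A B hA hB => simp only [Fml.subst, Force, hA, hB]

theorem force_of_deriv (hrefl : ∀ x, R x x) (htrans : ∀ x y z, R x y → R y z → R x z)
    {Γ : Set Fml} (hΓ : ∀ A ∈ Γ, ∀ V : ℕ → α → Prop, UpClosed R V → ∀ w, Force R V w A)
    {B : Fml} (h : Deriv Γ B) :
    ∀ V : ℕ → α → Prop, UpClosed R V → ∀ w, Force R V w B := by
  induction h with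
  | @ax A hA =>
    intro V hV w
    have mono : ∀ {n : ℕ} {w w' : α}, R w w' → V n w → V n w' := fun h h' => hV _ _ _ h' h
    simp only [IntAx, Set.mem_insert_iff, Set.mem_singleton_iff] at hA
    rcases hA with rfl | rfl | rfl | rfl | rfl | rfl | rfl | rfl | rfl | rfl
    · exact fun u _ hu v huv _ => mono huv hu
    · exact fun u _ hu v huv hv x hvx hx => hu x (htrans _ _ _ huv hvx) hx x (hrefl x) (hv x hvx hx)
    · exact fun u _ hu => hu.1
    · exact fun u _ hu => hu.2
    · exact fun u _ hu v huv hv => ⟨mono huv hu, hv⟩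
    · exact fun u _ hu => Or.inl hu
    · exact fun u _ hu => Or.inr hu
    · exact fun u _ hu v huv hv x hvx hx =>
        hx.elim (hu x (htrans _ _ _ huv hvx)) (hv x hvx)
    · exact fun u _ hu v huv hv x hvx hx =>
        hv x hvx hx x (hrefl x) (hu x (htrans _ _ _ huv hvx) hx)
    · exact fun u _ hu v huv hv => (hv v (hrefl v) (mono huv hu)).elim
  | extra hA => exact hΓ _ hA
  | mp _ _ h₁ h₂ => exact fun V hV w => h₁ V hV w w (hrefl w) (h₂ V hV w)
  | subst σ _ ih =>
    refine fun V hV w => force_subst.2 (ih _ (fun n w w' hw hww' => ?_) w)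
    exact force_mono (R := R) (V := V) htrans hV hww' hw

theorem force_conj {V : ℕ → α → Prop} {l : List Fml} {w : α} :
    Force R V w (conj l) ↔ ∀ A ∈ l, Force R V w A := by
  induction l with
  | nil => simp [conj, verum, Fml.neg, Force]
  | cons a l ih => simpa [conj, Force] using fun _ => ih

theorem force_disj {V : ℕ → α → Prop} {l : List Fml} {w : α} :
    Force R V w (disj l) ↔ ∃ A ∈ l, Force R V w A := by
  induction l with
  | nil => simp [disj, Force]
  | cons a l ih => simp only [disj] at ih; simp [disj, Force, ih]

end Kripke

/-! ### The frame -/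

/-- The points of the frame; `G` is the set of vectors that are represented. -/
inductive Pt (G : (Fin 4 → ℕ) → Prop) : Type
  | max (j : Fin 4)
  | mid (j : Fin 4)
  | lad (j : Fin 4) (s : Bool) (n : ℕ)
  | link (i : Fin 3)
  | vec (c : Fin 4 → ℕ) (h : G c)
  | root

namespace Pt

variable {G : (Fin 4 → ℕ) → Prop}

/-- The order of the frame. -/
def le : Pt G → Pt G → Prop
  | root, _ => True
  | vec c _, vec d _ => c = d
  | vec c _, lad j _ n => n ≤ c j + 1
  | vec _ _, mid _ => True
  | vec _ _, max _ => True
  | link i, link i' => i = i'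
  | link i, max j => fam i j = true
  | lad j s n, lad j' s' n' => j = j' ∧ ((s = s' ∧ n' ≤ n) ∨ n' + 2 ≤ n)
  | lad j _ n, mid j' => j = j' ∧ 1 ≤ n
  | lad j _ _, max j' => j = j'
  | mid j, mid j' => j = j'
  | mid j, max j' => j = j'
  | max j, max j' => j = j'
  | _, _ => False

theorem le_refl (w : Pt G) : le w w := by
  cases w <;> simp [le]

theorem le_trans {x y z : Pt G} (hxy : le x y) (hyz : le y z) : le x z := by
  cases x <;> cases y <;> cases z <;> simp only [le] at hxy hyz ⊢ <;>
    first
    | exact hxy.elim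
    | exact hyz.elim
    | (subst_vars; first | rfl | assumption)
    | skip
  all_goals try omega
  all_goals grind

theorem exists_max (w : Pt G) : ∃ k, le w (max k) := by
  cases w with
  | link i => revert i; simp only [le]; decide
  | _ => simp [le]

/-- The points lying over a single maximal point. -/
def Pure (j : Fin 4) (w : Pt G) : Prop := ∀ k, le w (max k) → k = j

theorem pure_iff {j : Fin 4} {w : Pt G} :
    Pure j w ↔ w = max j ∨ w = mid j ∨ ∃ s n, w = lad j s n := by
  cases w with
  | max k => simp [Pure, le]
  | mid k => simp [Pure, le]
  | lad k s n => simp [Pure, le]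
  | link i =>
    simp only [Pure, le, reduceCtorEq, exists_const, or_self, iff_false]
    revert i j; decide
  | vec c h =>
    simp only [Pure, le, reduceCtorEq, exists_const, or_self, iff_false]
    revert j; decide
  | root =>
    simp only [Pure, le, reduceCtorEq, exists_const, or_self, iff_false]
    revert j; decide

variable {V : ℕ → Pt G → Prop}

theorem force_up (hV : UpClosed le V) {A : Fml} {w w' : Pt G} (hw : le w w')
    (h : Force le V w A) : Force le V w' A :=
  force_mono (R := le) (V := V) (fun _ _ _ => le_trans) hV hw h

theorem force_neg (hV : UpClosed le V) {A : Fml} {w : Pt G} :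
    Force le V w A.neg ↔ ∀ k, le w (max k) → ¬ Force le V (max k) A := by
  constructor
  · exact fun h k hk => h _ hk
  · intro h u hu hA
    obtain ⟨k, hk⟩ := exists_max u
    exact h k (le_trans hu hk) (force_up hV hk hA)

/-- The maximal point `k` satisfies the description of region `j`. -/
def Col (V : ℕ → Pt G → Prop) (k j : Fin 4) : Prop := ∀ x : Fin 3, V x (max k) ↔ x.succ ≠ j

theorem force_region (hV : UpClosed le V) {j : Fin 4} {w : Pt G} :
    Force le V w (region j) ↔ ∀ k, le w (max k) → Col V k j := by
  have h : ∀ x : Fin 3,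
      Force le V w (if x.succ = j then (Fml.var x).neg else (Fml.var x).neg.neg) ↔
        ∀ k, le w (max k) → (V x (max k) ↔ x.succ ≠ j) := by
    intro x
    split
    · next h =>
      rw [force_neg hV]
      simp [h, Force]
    · next h =>
      rw [force_neg hV]
      simp only [force_neg hV]
      simp [h, Force, le]
  simp only [region, force_conj, List.forall_mem_map, List.mem_finRange, true_imp_iff, h]
  exact ⟨fun h k hk x => h x k hk, fun h x k hk => h k hk x⟩

theorem force_neg_region (hV : UpClosed le V) {j : Fin 4} {w : Pt G} :
    Force le V w (region j).neg ↔ ∀ k, le w (max k) → ¬ Col V k j := by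
  simp only [force_neg hV, force_region hV]
  refine forall₂_congr fun k _ => ?_
  simp [le]

theorem force_linkGuard (hV : UpClosed le V) {i : Fin 3} {w : Pt G} :
    ¬ Force le V w (linkGuard i) ↔
      ∃ u, le w u ∧ ∀ j, (∃ k, le u (max k) ∧ Col V k j) ↔ fam i j = true := by
  simp only [linkGuard, Force, force_conj, force_disj, List.mem_filter,
    List.mem_finRange, true_and, List.mem_map, exists_exists_and_eq_and, forall_exists_index,
    and_imp, forall_apply_eq_imp_iff₂, force_neg_region hV]
  push Not
  refine exists_congr fun u => and_congr_right fun _ => ?_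
  constructor
  · rintro ⟨h₁, h₂⟩ j
    constructor
    · rintro ⟨k, hk, hc⟩
      by_contra hj
      exact h₁ j (by simpa using hj) k hk hc
    · exact h₂ j
  · intro h
    refine ⟨fun j hj k hk hc => ?_, fun j hj => (h j).2 hj⟩
    have := (h j).1 ⟨k, hk, hc⟩
    simp [this] at hj

theorem force_lad_succ (hV : UpClosed le V) {j : Fin 4} {n : ℕ} {s : Bool} {w : Pt G}
    (h : Force le V w (ThreeVar.lad j n s)) : Force le V w (ThreeVar.lad j (n + 1) s) := by
  cases n with
  | zero => exact fun u hu _ => force_up hV hu h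
  | succ n => exact fun u hu _ => Or.inl (force_up hV hu h)

theorem force_lad_mono (hV : UpClosed le V) {j : Fin 4} {m n : ℕ} (hmn : m ≤ n) {s : Bool}
    {w : Pt G} (h : Force le V w (ThreeVar.lad j m s)) : Force le V w (ThreeVar.lad j n s) := by
  induction hmn with
  | refl => exact h
  | step _ ih => exact force_lad_succ hV ih

end Pt

end ThreeVar

namespace ThreeVar
open Paper
namespace Pt

variable {G : (Fin 4 → ℕ) → Prop} {V : ℕ → Pt G → Prop}

theorem not_force_lad_one (hV : UpClosed le V) (hcol : ∀ k j, Col V k j ↔ k = j) {j : Fin 4}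
    {s : Bool} {w : Pt G} : ¬ Force le V w (ThreeVar.lad j 1 s) ↔
      ∃ u, le w u ∧ Pure j u ∧ V (dataVar j !s) u ∧ ¬ V (dataVar j s) u := by
  simp only [ThreeVar.lad, Force, force_region hV, hcol]
  push Not
  simp only [Pure, and_assoc]

theorem not_force_lad_add_two (hV : UpClosed le V) (hcol : ∀ k j, Col V k j ↔ k = j) {j : Fin 4}
    {n : ℕ} {s : Bool} {w : Pt G} : ¬ Force le V w (ThreeVar.lad j (n + 2) s) ↔
      ∃ u, le w u ∧ Pure j u ∧ Force le V u (ThreeVar.lad j (n + 1) !s) ∧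
        ¬ Force le V u (ThreeVar.lad j (n + 1) s) ∧ ¬ Force le V u (ThreeVar.lad j n !s) := by
  simp only [ThreeVar.lad, Force, force_region hV, hcol]
  push Not
  simp only [Pure, and_assoc]

/-- The ladder of region `j` is shifted by `N`, and its sides are swapped if `t` holds. -/
def Shape (V : ℕ → Pt G → Prop) (j : Fin 4) (t : Bool) (N : ℕ) : Prop :=
  ∀ s, (∀ u, Pure j u →
    (V (dataVar j !s) u ∧ ¬ V (dataVar j s) u ↔ u = lad j (s ^^ t) N)) ∧
      ¬ V (dataVar j !s) (lad j (s ^^ t) (N + 1))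

theorem Pure.of_le {j : Fin 4} {u w : Pt G} (hu : Pure j u) (h : le u w) : Pure j w :=
  fun k hk => hu k (le_trans h hk)

theorem pure_lad (j : Fin 4) (s : Bool) (n : ℕ) : Pure j (lad j s n : Pt G) :=
  pure_iff.2 (Or.inr (Or.inr ⟨s, n, rfl⟩))

theorem data_max (hcol : ∀ k j, Col V k j ↔ k = j) (j : Fin 4) (s : Bool) :
    V (dataVar j s) (max j) := by
  have : ∃ x : Fin 3, (x : ℕ) = dataVar j s ∧ x.succ ≠ j := by revert j s; decide
  obtain ⟨x, hx, hxj⟩ := this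
  exact hx ▸ ((hcol j j).2 rfl x).2 hxj

theorem force_lad_iff (hV : UpClosed le V) (hcol : ∀ k j, Col V k j ↔ k = j) {j : Fin 4}
    {t : Bool} {N : ℕ} (hS : Shape V j t N) (i : ℕ) (s : Bool) (w : Pt G) :
    Force le V w (ThreeVar.lad j (i + 1) s) ↔ ¬ le w (lad j (s ^^ t) (N + i)) := by
  suffices h : ¬ Force le V w (ThreeVar.lad j (i + 1) s) ↔ le w (lad j (s ^^ t) (N + i)) by
    rw [← h, not_not]
  induction i using Nat.strong_induction_on generalizing s w with
  | _ i ih =>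
    have swap : ∀ {n : ℕ} {u : Pt G}, Pure j u → (¬ le u (lad j ((!s) ^^ t) n) ∧
        le u (lad j (s ^^ t) n) ↔ u = lad j (s ^^ t) n ∨ u = lad j (s ^^ t) (n + 1)) := by
      intro n u hu
      rcases pure_iff.1 hu with rfl | rfl | ⟨s', m, rfl⟩
      · simp [le]
      · simp [le]
      · simp only [le, lad.injEq, true_and]
        cases s <;> cases t <;> cases s' <;> simp <;> omega
    match i, ih with
    | 0, _ =>
      rw [not_force_lad_one hV hcol]
      constructor
      · rintro ⟨u, hu, hp, hd⟩
        rwa [((hS s).1 u hp).1 hd] at hu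
      · exact fun h => ⟨_, h, pure_lad _ _ _, ((hS s).1 _ (pure_lad _ _ _)).2 rfl⟩
    | 1, ih =>
      have e : ∀ s u, ¬ Force le V u (ThreeVar.lad j 1 s) ↔ le u (lad j (s ^^ t) N) :=
        ih 0 (by omega)
      rw [not_force_lad_add_two hV hcol]
      simp only [Nat.zero_add, e]
      constructor
      · rintro ⟨u, hu, hp, h1, h2, h3⟩
        rcases (swap hp).1 ⟨fun h => (e _ _).2 h h1, h2⟩ with rfl | rfl
        · exact (h3 (((hS s).1 _ hp).2 rfl).1).elim
        · exact hu
      · intro h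
        obtain ⟨h1, h2⟩ := (swap (n := N) (pure_lad j (s ^^ t) (N + 1))).2 (Or.inr rfl)
        exact ⟨_, h, pure_lad _ _ _, not_not.1 fun h' => h1 ((e _ _).1 h'), h2, (hS s).2⟩
    | i + 2, ih =>
      have e : ∀ s u, ¬ Force le V u (ThreeVar.lad j (i + 2) s) ↔
        le u (lad j (s ^^ t) (N + i + 1)) := ih (i + 1) (by omega)
      have e' : ∀ s u, ¬ Force le V u (ThreeVar.lad j (i + 1) s) ↔
        le u (lad j (s ^^ t) (N + i)) := ih i (by omega)
      rw [not_force_lad_add_two hV hcol]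
      constructor
      · rintro ⟨u, hu, hp, h1, h2, h3⟩
        rcases (swap hp).1 ⟨fun h => (e _ _).2 h h1, (e _ _).1 h2⟩ with rfl | rfl
        · have := (e' _ _).1 h3
          simp only [le, true_and] at this
          cases s <;> cases t <;> simp at this
        · exact hu
      · intro h
        obtain ⟨h1, h2⟩ := (swap (n := N + i + 1) (pure_lad j (s ^^ t) _)).2 (Or.inr rfl)
        refine ⟨_, h, pure_lad _ _ _, not_not.1 fun h' => h1 ((e _ _).1 h'), (e _ _).2 h2,
          (e' _ _).2 ?_⟩
        simp [le]
        omega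

theorem exists_shape (hV : UpClosed le V) (hcol : ∀ k j, Col V k j ↔ k = j) {j : Fin 4}
    (h : ∀ s, ∃ w, ¬ Force le V w (ThreeVar.lad j 2 s)) : ∃ t N, Shape V j t N := by
  have h1 : ∀ s, ∃ z x : Pt G, Pure j z ∧ le z x ∧ V (dataVar j !s) x ∧
      ¬ V (dataVar j s) x ∧ ¬ V (dataVar j !s) z ∧
      ∀ y, le z y → ¬ (V (dataVar j s) y ∧ ¬ V (dataVar j !s) y) := by
    intro s
    obtain ⟨w, hw⟩ := h s
    obtain ⟨z, -, hp, hz1, hz2, hz3⟩ := (not_force_lad_add_two hV hcol).1 hw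
    obtain ⟨x, hzx, -, hx⟩ := (not_force_lad_one hV hcol).1 hz2
    refine ⟨z, x, hp, hzx, hx.1, hx.2, hz3, fun y hy hd => ?_⟩
    refine (not_force_lad_one hV hcol).2 ⟨y, hy, hp.of_le hy, ?_⟩ hz1
    simpa using hd
  choose z x hp hzx hx1 hx2 hz hzy using h1
  have hU : ∀ s u w, le u w → ¬ V (dataVar j s) w → ¬ V (dataVar j s) u :=
    fun s u w huw hw hu => hw (hV _ _ _ hu huw)
  have hxmax : ∀ s, x s ≠ max j := fun s e => hx2 s (e ▸ data_max hcol j s)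
  have hne : ∀ s, x s ≠ z s := fun s e => hz s (e ▸ hx1 s)
  have hzl : ∀ s, ∃ b n, z s = lad j b n := by
    intro s
    rcases pure_iff.1 (hp s) with e | e | e
    · have := hzx s
      rcases pure_iff.1 ((hp s).of_le (hzx s)) with e' | e' | ⟨_, _, e'⟩
      · exact (hxmax s e').elim
      · rw [e, e'] at this; exact this.elim
      · rw [e, e'] at this; exact this.elim
    · have := hzx s
      rcases pure_iff.1 ((hp s).of_le (hzx s)) with e' | e' | ⟨_, _, e'⟩
      · exact (hxmax s e').elim
      · exact (hne s (e'.trans e.symm)).elim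
      · rw [e, e'] at this; exact this.elim
    · exact e
  have hzx' : ∀ s, ¬ le (z (!s)) (x s) :=
    fun s hle => hzy (!s) _ hle ⟨by simpa using hx1 s, by simpa using hx2 s⟩
  have hxl : ∀ s, x s = mid j ∨ ∃ b n, x s = lad j b n := by
    intro s
    exact (pure_iff.1 ((hp s).of_le (hzx s))).resolve_left (hxmax s)
  obtain ⟨b, n, ezt⟩ := hzl true
  obtain ⟨b', n', ezf⟩ := hzl false
  have a1 := hzx true
  have a2 := hzx false
  have a3 := hzx' true
  have a4 := hzx' false
  have a5 := hne true
  have a6 := hne false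
  simp only [Bool.not_true, Bool.not_false, ezt, ezf] at a1 a2 a3 a4 a5 a6
  have key : ∃ t N, ∀ s, x s = lad j (s ^^ t) N ∧ z s = lad j (s ^^ t) (N + 1) := by
    rcases hxl true with ext | ⟨c, m, ext⟩ <;> rcases hxl false with exf | ⟨c', m', exf⟩ <;>
      simp only [ext, exf, le, true_and] at a1 a2 a3 a4 a5 a6
    · omega
    · simp only [ne_eq, lad.injEq, true_and, not_and] at a6
      grind
    · simp only [ne_eq, lad.injEq, true_and, not_and] at a5
      grind
    · simp only [ne_eq, lad.injEq, true_and, not_and] at a5 a6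
      refine ⟨!b, m, ?_⟩
      rw [Bool.forall_bool, ezt, ezf, ext, exf]
      simp only [lad.injEq, true_and]
      cases b <;> cases b' <;> cases c <;> cases c' <;> simp_all <;> omega
  obtain ⟨t, N, hk⟩ := key
  refine ⟨t, N, fun s => ⟨fun u hu => ⟨fun hd => ?_, fun e => ?_⟩, ?_⟩⟩
  · have b1 : ¬ le u (z s) := fun h => hU _ _ _ h (hz s) hd.1
    have b2 : ¬ le u (x (!s)) := fun h => hU _ _ _ h (hx2 _) hd.1
    have b3 : ¬ le (z (!s)) u := fun h => hzy _ _ h ⟨by simpa using hd.1, by simpa using hd.2⟩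
    rw [(hk s).2] at b1
    rw [(hk _).1] at b2
    rw [(hk _).2] at b3
    rcases pure_iff.1 hu with rfl | rfl | ⟨s', m, rfl⟩
    · exact (hd.2 (data_max hcol j s)).elim
    · simp [le] at b3
    · simp only [le, lad.injEq, true_and] at b1 b2 b3 ⊢
      cases s <;> cases t <;> cases s' <;> simp at b1 b2 b3 ⊢ <;> omega
  · rw [e, ← (hk s).1]; exact ⟨hx1 s, hx2 s⟩
  · rw [← (hk s).2]; exact hz s

end Pt
end ThreeVar

namespace ThreeVar
open Paper
namespace Pt

variable {G : (Fin 4 → ℕ) → Prop} {V : ℕ → Pt G → Prop}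

theorem mem_sides (t : Fin 4 × Bool) : t ∈ sides := by
  revert t; decide

theorem not_force_mainFml {c : Fin 4 → ℕ} {w : Pt G} : ¬ Force le V w (mainFml c) ↔
    ∃ u, le w u ∧ (∀ j s, Force le V u (ThreeVar.lad j (c j + 3) s)) ∧
      ∀ j s, ¬ Force le V u (ThreeVar.lad j (c j + 2) s) := by
  have h3 : ∀ u : Pt G, Force le V u (conj (sides.map fun t => ThreeVar.lad t.1 (c t.1 + 3) t.2)) ↔
      ∀ j s, Force le V u (ThreeVar.lad j (c j + 3) s) := fun u => by
    rw [force_conj, List.forall_mem_map]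
    exact ⟨fun h j s => h (j, s) (mem_sides _), fun h t _ => h t.1 t.2⟩
  have h2 : ∀ u : Pt G, Force le V u (disj (sides.map fun t => ThreeVar.lad t.1 (c t.1 + 2) t.2)) ↔
      ∃ j s, Force le V u (ThreeVar.lad j (c j + 2) s) := fun u => by
    simp only [force_disj, List.mem_map, exists_exists_and_eq_and]
    exact ⟨fun ⟨t, _, h⟩ => ⟨t.1, t.2, h⟩, fun ⟨j, s, h⟩ => ⟨(j, s), mem_sides _, h⟩⟩
  simp only [mainFml, Force, h2, h3]
  push Not
  rfl

theorem exists_col (hV : UpClosed le V) {j : Fin 4} {n : ℕ} {s : Bool} {w : Pt G}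
    (h : ¬ Force le V w (ThreeVar.lad j (n + 2) s)) : ∃ k, le w (max k) ∧ Col V k j := by
  simp only [ThreeVar.lad, Force] at h
  push Not at h
  obtain ⟨u, hu, h, -⟩ := h
  obtain ⟨k, hk⟩ := exists_max u
  exact ⟨k, le_trans hu hk, (force_region hV).1 h.1 k hk⟩

theorem Col.unique {k i j : Fin 4} (hi : Col V k i) (hj : Col V k j) : i = j := by
  have : ∀ i j : Fin 4, (∀ x : Fin 3, x.succ ≠ i ↔ x.succ ≠ j) → i = j := by decide
  exact this i j fun x => (hi x).symm.trans (hj x)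

set_option maxRecDepth 10000 in
theorem fam_rigid : ∀ π : Fin 4 → Fin 4, Function.Injective π →
    (∀ i, ∃ i', ∀ j, fam i' (π j) = fam i j) → ∀ j, π j = j := by
  decide

theorem seen_cases (u : Pt G) : (∃ k, ∀ j, le u (max j) → j = k) ∨ (∀ j, le u (max j)) ∨
    ∃ i, u = link i := by
  cases u <;> simp [le]

theorem rigid (hV : UpClosed le V) {c : Fin 4 → ℕ} {w : Pt G}
    (hl : ¬ Force le V w linkGuards) (hm : ¬ Force le V w (mainFml c)) :
    (∀ k j, Col V k j ↔ k = j) ∧ w = root := by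
  obtain ⟨u, hwu, -, hu⟩ := not_force_mainFml.1 hm
  choose π hπu hπ using fun j => exists_col hV (hu j true)
  have hinj : Function.Injective π := fun i j h => (hπ i).unique (h ▸ hπ j)
  have hsurj := Finite.surjective_of_injective hinj
  have hcol : ∀ k j, Col V k j ↔ k = π j := by
    intro k j
    constructor
    · intro h
      obtain ⟨j', rfl⟩ := hsurj k
      rw [(hπ j').unique h]
    · rintro rfl; exact hπ j
  have hlink : ∀ i, ∃ i', le w (link i') ∧ ∀ j, fam i' (π j) = fam i j := by
    intro i
    have hi : ¬ Force le V w (linkGuard i) := fun h => hl (force_disj.2 ⟨_, by simp, h⟩)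
    obtain ⟨v, hwv, hv⟩ := (force_linkGuard hV).1 hi
    have hv' : ∀ j, le v (max (π j)) ↔ fam i j = true := by
      intro j
      rw [← hv j]
      exact ⟨fun h => ⟨_, h, hπ j⟩, fun ⟨k, hk, hc⟩ => (hcol k j).1 hc ▸ hk⟩
    rcases seen_cases v with ⟨k, hk⟩ | hall | ⟨i', rfl⟩
    · have : ∀ i, ∃ j j', j ≠ j' ∧ fam i j = true ∧ fam i j' = true := by decide
      obtain ⟨j, j', hne, h1, h2⟩ := this i
      exact (hne (hinj ((hk _ ((hv' j).2 h1)).trans (hk _ ((hv' j').2 h2)).symm))).elim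
    · have : ∀ i, ∃ j, fam i j = false := by decide
      obtain ⟨j, hj⟩ := this i
      have := (hv' j).1 (hall _)
      simp [hj] at this
    · exact ⟨i', hwv, fun j => Bool.eq_iff_iff.2 (hv' j)⟩
  have hid := fam_rigid π hinj fun i => (hlink i).imp fun _ h => h.2
  refine ⟨fun k j => by rw [hcol, hid], ?_⟩
  obtain ⟨i, hi, -⟩ := hlink 0
  have hall : ∀ j, le w (max j) := fun j => by
    have := le_trans hwu (hπu j)
    rwa [hid] at this
  cases w with
  | root => rfl
  | link i' =>
    have : ∀ i, ∃ j, fam i j = false := by decide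
    obtain ⟨j, hj⟩ := this i'
    have := hall j
    simp [le, hj] at this
  | _ => exact hi.elim

theorem zero_of_zeroGuard (hV : UpClosed le V) (hcol : ∀ k j, Col V k j ↔ k = j) {j : Fin 4}
    {t : Bool} {N : ℕ} (hS : Shape V j t N) {w : Pt G} (h : ¬ Force le V w (zeroGuard j)) :
    N = 0 := by
  simp only [zeroGuard, Force, force_region hV, hcol] at h
  push Not at h
  obtain ⟨u, -, ⟨hp, h1, h2⟩, h3, h4⟩ := h
  by_contra hN
  have hl : ∀ s, ¬ le u (lad j s N) := by
    intro s
    have key : ∀ s, Force le V u (ThreeVar.lad j 1 s) := by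
      intro s; cases s <;> assumption
    have := (force_lad_iff hV hcol hS 0 (s ^^ t) u).1 (key _)
    simpa using this
  have hd : ∀ s, ¬ V (dataVar j s) u := by
    intro s
    cases s
    exacts [h4, h3]
  have hge : ∃ s, le (lad j s N) u := by
    rcases pure_iff.1 hp with rfl | rfl | ⟨s, n, rfl⟩
    · exact (hd true (data_max hcol j _)).elim
    · exact ⟨true, by simp [le]; omega⟩
    · have := hl s
      exact ⟨s, by simp [le] at this ⊢; omega⟩
  obtain ⟨s, hs⟩ := hge
  have := ((hS (s ^^ t)).1 (lad j s N) (pure_lad _ _ _)).2 (by simp)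
  exact hd _ (hV _ _ _ this.1 hs)

theorem not_force_goalFml (hV : UpClosed le V) {z : Fin 4 → Bool} {c : Fin 4 → ℕ} {w : Pt G}
    (h : ¬ Force le V w (goalFml z c)) : w = root ∧ ∃ N : Fin 4 → ℕ,
      (∀ j, z j = true → N j = 0) ∧ G (N + c) ∧
        ∀ d, G (N + d) → ¬ Force le V root (mainFml d) := by
  simp only [goalFml, Force] at h
  push Not at h
  obtain ⟨hl, hz, hm⟩ := h
  obtain ⟨hcol, rfl⟩ := rigid hV hl hm
  obtain ⟨u, -, hu3, hu2⟩ := not_force_mainFml.1 hm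
  choose t N hS using fun j => exists_shape hV hcol fun s =>
    ⟨u, fun h => hu2 j s (force_lad_mono hV (by omega) h)⟩
  have hlad := fun j => force_lad_iff hV hcol (hS j)
  refine ⟨rfl, N, fun j hj => zero_of_zeroGuard hV hcol (hS j) (w := root) fun h =>
    hz (force_disj.2 ⟨_, List.mem_map.2 ⟨j, by simpa using hj, rfl⟩, h⟩), ?_, fun d hd => ?_⟩
  · have h2 : ∀ j s, le u (lad j (s ^^ t j) (N j + (c j + 1))) := fun j s =>
      not_not.1 fun h => hu2 j s ((hlad j _ s u).2 h)
    have h3 : ∀ j s, ¬ le u (lad j (s ^^ t j) (N j + (c j + 2))) := fun j s =>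
      (hlad j _ s u).1 (hu3 j s)
    cases u with
    | vec e he =>
      have : N + c = e := by
        funext j
        have h2 := h2 j true
        have h3 := h3 j true
        simp only [le] at h2 h3
        simp only [Pi.add_apply]
        omega
      exact this ▸ he
    | root => exact (h3 0 true trivial).elim
    | link i => exact (h2 0 true).elim
    | mid i => exact (h2 0 true).elim
    | max i => exact (h2 0 true).elim
    | lad i s n => exact absurd ((h2 0 true).1.symm.trans (h2 1 true).1) (by decide)
  · refine not_force_mainFml.2 ⟨vec _ hd, trivial, fun j s => (hlad j _ s _).2 ?_,
      fun j s h => (hlad j _ s _).1 h ?_⟩ <;>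
    · simp only [le, Pi.add_apply]
      omega

theorem axiomFml_valid {P : List Rule} (hV : UpClosed le V) (hG : ∀ c, G c ↔ ¬ Halts P c)
    (w : Pt G) : Force le V w (axiomFml P) := by
  refine force_conj.2 fun A hA => ?_
  obtain ⟨R, hR, rfl⟩ := List.mem_map.1 hA
  unfold Rule.fml
  split
  · next hd =>
    by_contra h
    obtain ⟨-, N, hN, hc, -⟩ := not_force_goalFml hV h
    exact (hG _).1 hc (.accept hR hd N hN)
  · next d hd =>
    intro u _ hu
    by_contra h
    obtain ⟨rfl, N, hN, hc, hN'⟩ := not_force_goalFml hV h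
    exact hN' d ((hG _).2 fun hh => (hG _).1 hc (.step hR d hd N hN hh)) hu

/-- The valuation in which no ladder is shifted. -/
def stdVal (G : (Fin 4 → ℕ) → Prop) (x : ℕ) (w : Pt G) : Prop :=
  (∀ k : Fin 3, (k : ℕ) = x → ¬ le w (max k.succ)) ∧
    ∀ j s, dataVar j s = x → ¬ le w (lad j s 0) ∧ ¬ le w (mid j)

theorem stdVal_upClosed : UpClosed le (stdVal G) := fun _ _ _ h hw =>
  ⟨fun k hk h' => h.1 k hk (le_trans hw h'), fun j s hj =>
    ⟨fun h' => (h.2 j s hj).1 (le_trans hw h'), fun h' => (h.2 j s hj).2 (le_trans hw h')⟩⟩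

theorem stdVal_col (k j : Fin 4) : Col (stdVal G) k j ↔ k = j := by
  have h : ∀ x : Fin 3, stdVal G x (max k) ↔ x.succ ≠ k := by
    intro x
    simp only [stdVal, le, not_false_eq_true, and_self, implies_true, and_true]
    constructor
    · exact fun h e => h x rfl e.symm
    · exact fun h x' e e' => h (by rw [e', Fin.ext e])
  have : ∀ k j : Fin 4, (∀ x : Fin 3, x.succ ≠ k ↔ x.succ ≠ j) ↔ k = j := by decide
  simp only [Col, h, this]

theorem stdVal_data {j : Fin 4} {s : Bool} {u : Pt G} (hu : Pure j u) :
    ¬ stdVal G (dataVar j s) u ↔ le u (lad j s 0) ∨ le u (mid j) := by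
  constructor
  · intro h
    by_contra hn
    push Not at hn
    refine h ⟨fun k hk h' => ?_, fun i s' he => ?_⟩
    · have : ∀ (j : Fin 4) s (k : Fin 3), (k : ℕ) = dataVar j s → k.succ ≠ j := by decide
      exact this j s k hk (hu _ h')
    · by_cases hij : i = j
      · subst hij
        rw [dataVar_injective he]
        exact hn
      · exact ⟨fun h' => hij (hu _ (le_trans h' (by simp [le]))),
          fun h' => hij (hu _ (le_trans h' (by simp [le])))⟩
  · rintro (h | h) hh
    · exact (hh.2 j s rfl).1 h
    · exact (hh.2 j s rfl).2 h

theorem stdVal_shape (j : Fin 4) : Shape (stdVal G) j false 0 := by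
  intro s
  refine ⟨fun u hu => ?_, ?_⟩
  · rw [stdVal_data hu, ← not_not (a := stdVal G _ u), stdVal_data hu]
    rcases pure_iff.1 hu with rfl | rfl | ⟨s', n, rfl⟩
    · simp [le]
    · simp [le]
    · simp only [le, lad.injEq, true_and]
      cases s <;> cases s' <;> simp <;> omega
  · rw [stdVal_data (pure_lad _ _ _)]
    simp [le]

theorem not_force_acceptFml {c : Fin 4 → ℕ} (hc : G c) :
    ¬ Force le (stdVal G) root (acceptFml c) := by
  have hV : UpClosed le (stdVal G) := stdVal_upClosed
  have hlad := fun j => force_lad_iff hV stdVal_col (stdVal_shape j)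
  rintro (h | h | h)
  · obtain ⟨A, hA, h⟩ := force_disj.1 h
    obtain ⟨i, -, rfl⟩ := List.mem_map.1 hA
    refine (force_linkGuard hV (w := root)).2 ⟨link i, trivial, fun j => ?_⟩ h
    simp [stdVal_col, le]
  · obtain ⟨A, hA, h⟩ := force_disj.1 h
    obtain ⟨j, -, rfl⟩ := List.mem_map.1 hA
    have hp : Pure j (mid j : Pt G) := pure_iff.2 (Or.inr (Or.inl rfl))
    have := h (mid j) trivial ⟨(force_region hV).2 fun k hk => (stdVal_col _ _).2 (hp k hk),
      (hlad j 0 _ _).2 (by simp [le]), (hlad j 0 _ _).2 (by simp [le])⟩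
    rcases this with h | h <;>
    · exact (stdVal_data hp).2 (Or.inr (le_refl _)) h
  · refine (not_force_mainFml (w := root)).2 ⟨vec c hc, trivial, fun j s => (hlad j _ s _).2 ?_,
      fun j s h => (hlad j _ s _).1 h ?_⟩ h <;>
    · simp only [le]
      omega

end Pt

theorem halts_of_deriv {P : List Rule} {c : Fin 4 → ℕ}
    (h : Deriv {axiomFml P} (acceptFml c)) : Halts P c := by
  by_contra hc
  refine Pt.not_force_acceptFml (G := fun c => ¬ Halts P c) hc ?_
  refine force_of_deriv (R := Pt.le) Pt.le_refl (fun _ _ _ => Pt.le_trans) ?_ h _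
    Pt.stdVal_upClosed _
  rintro A rfl V hV w
  exact Pt.axiomFml_valid hV (fun _ => Iff.rfl) w

theorem deriv_acceptFml_iff {P : List Rule} {c : Fin 4 → ℕ} :
    Deriv {axiomFml P} (acceptFml c) ↔ Halts P c :=
  ⟨halts_of_deriv, deriv_of_halts⟩

end ThreeVar

namespace ThreeVar
open Paper

/-- A one-tape machine restricted to a finite set of states closed under its transitions, with a
numbering of these states and of the tape symbols. -/
structure Numbered (Γ σ : Type) [Inhabited Γ] [Inhabited σ] where
  mach : Turing.TM0.Machine Γ σ
  states : Finset σ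
  closed : ∀ q ∈ states, ∀ a q' s, mach q a = some (q', s) → q' ∈ states
  num : σ → ℕ
  num_inj : Set.InjOn num states
  base : ℕ
  one_lt : 1 < base
  sym : ℕ → Γ
  sym_zero : sym 0 = default
  dig : Γ → ℕ
  dig_lt : ∀ a, dig a < base
  sym_dig : ∀ a, sym (dig a) = a

/-- Control states of the counter program simulating a one-tape machine. -/
inductive Ctl (σ : Type) : Type
  | run (q : σ) (d : ℕ)
  | scale (dir : Bool) (q : σ) (d : ℕ)
  | back (dir : Bool) (q : σ) (d : ℕ)
  | divide (dir : Bool) (q : σ)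
  | finish (dir : Bool) (q : σ) (d : ℕ)

/-- The machine state recorded by a control state. -/
def Ctl.state {σ : Type} : Ctl σ → σ
  | .run q _ => q
  | .scale _ q _ => q
  | .back _ q _ => q
  | .divide _ q => q
  | .finish _ q _ => q

/-- Numbers of control states. -/
def Ctl.code {σ : Type} (num : σ → ℕ) : Ctl σ → ℕ
  | .run q d => Nat.pair 0 (Nat.pair (num q) d)
  | .scale dir q d => Nat.pair (cond dir 1 2) (Nat.pair (num q) d)
  | .back dir q d => Nat.pair (cond dir 3 4) (Nat.pair (num q) d)
  | .divide dir q => Nat.pair (cond dir 5 6) (Nat.pair (num q) 0)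
  | .finish dir q d => Nat.pair (cond dir 7 8) (Nat.pair (num q) d)

theorem Ctl.code_inj {σ : Type} {num : σ → ℕ} {S : Set σ} (hn : Set.InjOn num S) {μ ν : Ctl σ}
    (hμ : μ.state ∈ S) (hν : ν.state ∈ S) (h : μ.code num = ν.code num) : μ = ν := by
  have hq : μ.state = ν.state := by
    refine hn hμ hν ?_
    have key : ∀ μ : Ctl σ, num μ.state = (μ.code num).unpair.2.unpair.1 := by
      rintro (_ | _ | _ | _ | _) <;> simp [Ctl.code, Ctl.state]
    rw [key, key, h]
  clear hμ hν
  rcases μ with ⟨q, d⟩ | ⟨_ | _, q, d⟩ | ⟨_ | _, q, d⟩ | ⟨_ | _, q⟩ | ⟨_ | _, q, d⟩ <;>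
    rcases ν with ⟨q', d'⟩ | ⟨_ | _, q', d'⟩ | ⟨_ | _, q', d'⟩ | ⟨_ | _, q'⟩ | ⟨_ | _, q', d'⟩ <;>
    simp_all [Ctl.code, Ctl.state]

/-- A vector with first coordinate `a`, third counter `z`, and the other two counters ordered
according to a direction. -/
def arr {α : Type} (dir : Bool) (a x y z : α) : Fin 4 → α :=
  cond dir ![a, x, y, z] ![a, y, x, z]

/-- The tape with a given head whose two sides are ordered according to a direction. -/
def tape {Γ : Type} [Inhabited Γ] (dir : Bool) (h : Γ) (x y : Turing.ListBlank Γ) :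
    Turing.Tape Γ :=
  cond dir ⟨h, x, y⟩ ⟨h, y, x⟩

/-- The direction of motion encoded by a Boolean. -/
def toDir (dir : Bool) : Turing.Dir := cond dir .right .left

theorem arr_add (dir : Bool) (a x y z a' x' y' z' : ℕ) :
    arr dir a x y z + arr dir a' x' y' z' = arr dir (a + a') (x + x') (y + y') (z + z') := by
  cases dir <;> simp [arr]

theorem exists_arr (dir : Bool) (N : Fin 4 → ℕ) : ∃ x y z, N = arr dir (N 0) x y z := by
  cases dir
  · exact ⟨N 2, N 1, N 3, by funext j; fin_cases j <;> rfl⟩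
  · exact ⟨N 1, N 2, N 3, by funext j; fin_cases j <;> rfl⟩

namespace Numbered

variable {Γ σ : Type} [Inhabited Γ] [Inhabited σ] (E : Numbered Γ σ)

/-- The half-tape whose symbols are the digits of a number. -/
def half (n : ℕ) : Turing.ListBlank Γ := Turing.ListBlank.mk ((Nat.digits E.base n).map E.sym)

theorem half_zero : E.half 0 = Turing.ListBlank.mk [] := by simp [half]

theorem half_cons {n d : ℕ} (hd : d < E.base) :
    E.half (E.base * n + d) = (E.half n).cons (E.sym d) := by
  by_cases h : d = 0 ∧ n = 0
  · obtain ⟨rfl, rfl⟩ := h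
    simp only [half, mul_zero, add_zero, Nat.digits_zero, List.map_nil, sym_zero,
      Turing.ListBlank.cons_mk]
    exact Quotient.sound' (Or.inl ⟨1, rfl⟩)
  · have : d ≠ 0 ∨ n ≠ 0 := by tauto
    rw [half, add_comm, Nat.digits_add E.base E.one_lt d n hd this]
    simp [half]

theorem half_eq (n : ℕ) : E.half n = (E.half (n / E.base)).cons (E.sym (n % E.base)) := by
  rw [← E.half_cons (Nat.mod_lt _ (by have := E.one_lt; omega)), Nat.div_add_mod]

theorem half_head (n : ℕ) : (E.half n).head = E.sym (n % E.base) := by rw [half_eq]; simp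

theorem half_tail (n : ℕ) : (E.half n).tail = E.half (n / E.base) := by rw [half_eq]; simp

theorem move_tape (dir : Bool) (d x y : ℕ) (hd : d < E.base) :
    (tape dir (E.sym d) (E.half x) (E.half y)).move (toDir dir) =
      tape dir (E.sym (y % E.base)) (E.half (E.base * x + d)) (E.half (y / E.base)) := by
  cases dir <;> simp [tape, toDir, Turing.Tape.move, half_head, half_tail, E.half_cons hd]

/-- The rule moving between two control states. -/
def mv (dir : Bool) (μ ν : Ctl σ) (fy fz : Bool) (fx : Bool) (x y z x' y' z' : ℕ) : Rule where
  src := arr dir (μ.code E.num) x y z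
  zero := arr dir true fx fy fz
  dst := some (arr dir (ν.code E.num) x' y' z')

/-- Halting, writing, or starting a move in a given state over a given symbol. -/
def stepRule (q : σ) (d : ℕ) : Rule :=
  match E.mach q (E.sym d) with
  | none => ⟨arr true ((Ctl.run q d).code E.num) 0 0 0, arr true true false false false, none⟩
  | some (q', .write a) =>
    E.mv true (.run q d) (.run q' (E.dig a)) false false false 0 0 0 0 0 0
  | some (q', .move .right) =>
    E.mv true (.run q d) (.scale true q' d) false true false 0 0 0 0 0 0
  | some (q', .move .left) =>
    E.mv false (.run q d) (.scale false q' d) false true false 0 0 0 0 0 0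

/-- The rules pushing a digit on one side and popping a digit from the other. -/
def loopRules (dir : Bool) (q : σ) (d : ℕ) : List Rule :=
  [E.mv dir (.scale dir q d) (.scale dir q d) false false false 1 0 0 0 0 E.base,
   E.mv dir (.scale dir q d) (.back dir q d) false false true 0 0 0 0 0 0,
   E.mv dir (.back dir q d) (.back dir q d) false false false 0 0 1 1 0 0,
   E.mv dir (.back dir q d) (.divide dir q) false true false 0 0 0 d 0 0,
   E.mv dir (.divide dir q) (.divide dir q) false false false 0 E.base 0 0 0 1,
   E.mv dir (.divide dir q) (.finish dir q d) true false false 0 d 0 0 0 0,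
   E.mv dir (.finish dir q d) (.finish dir q d) false false false 0 0 1 0 1 0,
   E.mv dir (.finish dir q d) (.run q d) false true false 0 0 0 0 0 0]

/-- The counter program simulating the machine. -/
noncomputable def program : List Rule :=
  E.states.toList.flatMap fun q => (List.range E.base).flatMap fun d =>
    E.stepRule q d :: (E.loopRules true q d ++ E.loopRules false q d)

theorem mem_program {R : Rule} : R ∈ E.program ↔ ∃ q ∈ E.states, ∃ d < E.base,
    R = E.stepRule q d ∨ ∃ dir, R ∈ E.loopRules dir q d := by
  simp only [program, List.mem_flatMap, Finset.mem_toList, List.mem_range, List.mem_cons,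
    List.mem_append, Bool.exists_bool, or_comm]

/-- Termination of the machine from a configuration. -/
def Stops (c : Turing.TM0.Cfg Γ σ) : Prop :=
  (StateTransition.eval (Turing.TM0.step E.mach) c).Dom

theorem stops_of_none {c : Turing.TM0.Cfg Γ σ} (h : Turing.TM0.step E.mach c = none) :
    E.Stops c :=
  Part.dom_iff_mem.2 ⟨c, StateTransition.mem_eval.2 ⟨.refl, h⟩⟩

theorem stops_step {c c' : Turing.TM0.Cfg Γ σ} (h : Turing.TM0.step E.mach c = some c') :
    E.Stops c ↔ E.Stops c' := by
  rw [Stops, StateTransition.reaches_eval (Relation.ReflTransGen.single h), Stops]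

/-- The machine configuration represented by a control state with given counters. -/
def conf (μ : Ctl σ) (dir : Bool) (x y z : ℕ) : Turing.TM0.Cfg Γ σ :=
  match μ with
  | .run q d => ⟨q, tape dir (E.sym d) (E.half x) (E.half y)⟩
  | .scale _ q d => ⟨q, tape dir (E.sym (y % E.base)) (E.half (E.base * x + z + d))
      (E.half (y / E.base))⟩
  | .back _ q d => ⟨q, tape dir (E.sym (y % E.base)) (E.half (x + z + d)) (E.half (y / E.base))⟩
  | .divide _ q => ⟨q, tape dir (E.sym ((y + E.base * z) % E.base)) (E.half x)
      (E.half ((y + E.base * z) / E.base))⟩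
  | .finish _ q d => ⟨q, tape dir (E.sym d) (E.half x) (E.half (y + z))⟩

/-- The direction in which the counters of a control state are read. -/
def _root_.ThreeVar.Ctl.Reads {σ : Type} (dir : Bool) : Ctl σ → Prop
  | .run _ _ => True
  | .scale e _ _ => e = dir
  | .back e _ _ => e = dir
  | .divide e _ => e = dir
  | .finish e _ _ => e = dir

theorem conf_swap {μ : Ctl σ} {dir e : Bool} (hd : μ.Reads dir) (he : μ.Reads e)
    {a a' x y z x' y' z' : ℕ} (h : arr dir a x y z = arr e a' x' y' z') :
    E.conf μ dir x y z = E.conf μ e x' y' z' := by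
  have h₁ := congrFun h 1
  have h₂ := congrFun h 2
  have h₃ := congrFun h 3
  cases dir <;> cases e <;> simp [arr] at h₁ h₂ h₃ <;> subst h₁ h₂ h₃ <;>
    cases μ <;> simp_all [Ctl.Reads, conf, tape]

/-- Every control state represented by the vector stops. -/
def Sound (v : Fin 4 → ℕ) : Prop :=
  ∀ (μ : Ctl σ) (dir : Bool) (x y z : ℕ), μ.state ∈ E.states → μ.Reads dir →
    v = arr dir (μ.code E.num) x y z → E.Stops (E.conf μ dir x y z)

theorem sound_arr {μ : Ctl σ} {dir : Bool} (hs : μ.state ∈ E.states) (hd : μ.Reads dir)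
    {x y z : ℕ} : E.Sound (arr dir (μ.code E.num) x y z) ↔ E.Stops (E.conf μ dir x y z) := by
  refine ⟨fun h => h μ dir x y z hs hd rfl, fun h ν e x' y' z' hν he heq => ?_⟩
  have : μ = ν := by
    refine Ctl.code_inj E.num_inj hs hν ?_
    have := congrFun heq 0
    cases dir <;> cases e <;> simpa [arr] using this
  subst this
  rwa [← E.conf_swap hd he heq]

theorem sound_mv {dir : Bool} {μ ν : Ctl σ} {fx fy fz : Bool} {x y z x' y' z' : ℕ}
    (hμ : μ.state ∈ E.states) (hμd : μ.Reads dir) (hν : ν.state ∈ E.states) (hνd : ν.Reads dir)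
    (h : ∀ X Y Z, (fx = true → X = 0) → (fy = true → Y = 0) → (fz = true → Z = 0) →
      E.Stops (E.conf ν dir (X + x') (Y + y') (Z + z')) →
      E.Stops (E.conf μ dir (X + x) (Y + y) (Z + z)))
    {N d : Fin 4 → ℕ} (hN : (E.mv dir μ ν fy fz fx x y z x' y' z').Ok N)
    (hd : (E.mv dir μ ν fy fz fx x y z x' y' z').dst = some d) (hs : E.Sound (N + d)) :
    E.Sound (N + (E.mv dir μ ν fy fz fx x y z x' y' z').src) := by
  obtain ⟨X, Y, Z, hX⟩ := exists_arr dir N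
  obtain ⟨h0, hx, hy, hz⟩ : N 0 = 0 ∧ (fx = true → X = 0) ∧ (fy = true → Y = 0) ∧
      (fz = true → Z = 0) := by
    have e0 := hN 0
    have e1 := hN 1
    have e2 := hN 2
    have e3 := hN 3
    rw [hX] at e1 e2 e3
    cases dir <;> simp [mv, arr] at e0 e1 e2 e3 <;> tauto
  rw [h0] at hX
  simp only [mv, Option.some.injEq] at hd ⊢
  rw [hX, arr_add, zero_add, E.sound_arr hμ hμd]
  rw [hX, ← hd, arr_add, zero_add, E.sound_arr hν hνd] at hs
  exact h X Y Z hx hy hz hs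

theorem halts_mv {dir : Bool} {μ ν : Ctl σ} {fx fy fz : Bool} {x y z x' y' z' : ℕ}
    (hR : E.mv dir μ ν fy fz fx x y z x' y' z' ∈ E.program) {X Y Z : ℕ}
    (hx : fx = true → X = 0) (hy : fy = true → Y = 0) (hz : fz = true → Z = 0)
    (h : Halts E.program (arr dir (ν.code E.num) (X + x') (Y + y') (Z + z'))) :
    Halts E.program (arr dir (μ.code E.num) (X + x) (Y + y) (Z + z)) := by
  have := Halts.step hR _ rfl (arr dir 0 X Y Z) ?_ ?_
  · simpa only [mv, arr_add, zero_add] using this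
  · intro j
    cases dir <;> fin_cases j <;> simp [mv, arr] <;> assumption
  · simpa only [arr_add, zero_add] using h

theorem step_conf_run (q : σ) (d : ℕ) (dir : Bool) (x y z : ℕ) :
    Turing.TM0.step E.mach (E.conf (.run q d) dir x y z) =
      (E.mach q (E.sym d)).map fun r => ⟨r.1, match r.2 with
        | .move D => (tape dir (E.sym d) (E.half x) (E.half y)).move D
        | .write a => tape dir a (E.half x) (E.half y)⟩ := by
  cases dir <;> simp only [conf, Turing.TM0.step, tape, cond] <;>
    rcases E.mach q (E.sym d) with _ | ⟨q', D | a⟩ <;> rfl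

theorem sound_of_halts {v : Fin 4 → ℕ} (h : Halts E.program v) : E.Sound v := by
  have hb := E.one_lt
  induction h with
  | @accept R hR hd N hN =>
    obtain ⟨q, hq, d, hdb, rfl | ⟨dir, hR⟩⟩ := E.mem_program.1 hR
    · obtain ⟨X, Y, Z, hX⟩ := exists_arr true N
      rcases hm : E.mach q (E.sym d) with _ | ⟨q', (_ | _) | a⟩ <;>
        simp only [stepRule, hm, mv, reduceCtorEq] at hd hN ⊢
      have h0 : N 0 = 0 := hN 0 rfl
      rw [hX, arr_add, h0, zero_add, E.sound_arr (μ := .run q d) hq trivial]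
      refine E.stops_of_none ?_
      rw [E.step_conf_run, hm]
      rfl
    · simp only [loopRules, List.mem_cons, List.not_mem_nil, or_false] at hR
      rcases hR with rfl | rfl | rfl | rfl | rfl | rfl | rfl | rfl <;> simp [mv] at hd
  | @step R hR e hd N hN h ih =>
    obtain ⟨q, hq, d, hdb, rfl | ⟨dir, hR⟩⟩ := E.mem_program.1 hR
    · rcases hm : E.mach q (E.sym d) with _ | ⟨q', (_ | _) | a⟩ <;>
        simp only [stepRule, hm] at hd hN ⊢
      · simp at hd
      · refine E.sound_mv (μ := .run q d) (ν := .scale false q' d) hq trivial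
          (E.closed _ hq _ _ _ hm) rfl ?_ hN hd ih
        intro X Y Z _ _ hZ hs
        refine (E.stops_step ((E.step_conf_run ..).trans (by rw [hm]; rfl))).2 ?_
        convert hs using 1
        simp only [conf, hZ, add_zero]
        exact congrArg _ (E.move_tape false d X Y hdb)
      · refine E.sound_mv (μ := .run q d) (ν := .scale true q' d) hq trivial
          (E.closed _ hq _ _ _ hm) rfl ?_ hN hd ih
        intro X Y Z _ _ hZ hs
        refine (E.stops_step ((E.step_conf_run ..).trans (by rw [hm]; rfl))).2 ?_
        convert hs using 1
        simp only [conf, hZ, add_zero]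
        exact congrArg _ (E.move_tape true d X Y hdb)
      · refine E.sound_mv (μ := .run q d) (ν := .run q' (E.dig a)) hq trivial
          (E.closed _ hq _ _ _ hm) trivial ?_ hN hd ih
        intro X Y Z _ _ hZ hs
        refine (E.stops_step ((E.step_conf_run ..).trans (by rw [hm]; rfl))).2 ?_
        convert hs using 1
        simp only [conf, sym_dig, add_zero]
    · simp only [loopRules, List.mem_cons, List.not_mem_nil, or_false] at hR
      rcases hR with rfl | rfl | rfl | rfl | rfl | rfl | rfl | rfl <;>
        refine E.sound_mv (by exact hq) (by constructor) (by exact hq) (by constructor) ?_ hN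
          hd ih <;>
        intro X Y Z hX hY hZ hs <;> convert hs using 1 <;> simp only [conf, add_zero]
      · rw [show E.base * (X + 1) + Z + d = E.base * X + (Z + E.base) + d by ring]
      · simp [hX]
      · rw [show X + (Z + 1) + d = X + 1 + Z + d by ring]
      · simp [hZ]
      · rw [show Y + E.base + E.base * Z = Y + E.base * (Z + 1) by ring]
      · rw [hY rfl, zero_add, Nat.add_mul_mod_self_left, Nat.mod_eq_of_lt hdb,
          Nat.add_mul_div_left _ _ (by omega), Nat.div_eq_of_lt hdb]
      · rw [show Y + (Z + 1) = Y + 1 + Z by ring]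
      · simp [hZ]

theorem loopRules_subset {q : σ} (hq : q ∈ E.states) {d : ℕ} (hd : d < E.base) {dir : Bool}
    {R : Rule} (h : R ∈ E.loopRules dir q d) : R ∈ E.program :=
  E.mem_program.2 ⟨q, hq, d, hd, .inr ⟨dir, h⟩⟩

theorem halts_finish {q : σ} (hq : q ∈ E.states) {d : ℕ} (hd : d < E.base) {dir : Bool} {x : ℕ} :
    ∀ {z y : ℕ}, Halts E.program (arr dir ((Ctl.run q d).code E.num) x (y + z) 0) →
      Halts E.program (arr dir ((Ctl.finish dir q d).code E.num) x y z) := by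
  intro z
  induction z with
  | zero =>
    intro y h
    have hR : E.mv dir (.finish dir q d) (.run q d) false true false 0 0 0 0 0 0
        ∈ E.loopRules dir q d := by simp [loopRules]
    exact E.halts_mv (μ := .finish dir q d) (ν := .run q d) (X := x) (Y := y) (Z := 0)
      (E.loopRules_subset hq hd hR)
      (by simp) (by simp) (by simp) h
  | succ z ih =>
    intro y h
    have hR : E.mv dir (.finish dir q d) (.finish dir q d) false false false 0 0 1 0 1 0
        ∈ E.loopRules dir q d := by simp [loopRules]
    exact E.halts_mv (μ := .finish dir q d) (ν := .finish dir q d) (X := x) (Y := y) (Z := z)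
      (E.loopRules_subset hq hd hR)
      (by simp) (by simp) (by simp) (ih (by rwa [add_assoc, add_comm 1]))

theorem halts_divide {q : σ} (hq : q ∈ E.states) {d : ℕ} (hd : d < E.base) {dir : Bool} {x : ℕ} :
    ∀ {y z : ℕ}, Halts E.program (arr dir ((Ctl.run q d).code E.num) x (y + z) 0) →
      Halts E.program (arr dir ((Ctl.divide dir q).code E.num) x (E.base * y + d) z) := by
  intro y
  induction y with
  | zero =>
    intro z h
    rw [mul_zero]
    have hR : E.mv dir (.divide dir q) (.finish dir q d) true false false 0 d 0 0 0 0
        ∈ E.loopRules dir q d := by simp [loopRules]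
    exact E.halts_mv (μ := .divide dir q) (ν := .finish dir q d) (X := x) (Y := 0) (Z := z)
      (E.loopRules_subset hq hd hR)
      (by simp) (by simp) (by simp) (E.halts_finish hq hd h)
  | succ y ih =>
    intro z h
    rw [show E.base * (y + 1) + d = E.base * y + d + E.base by ring]
    have hR : E.mv dir (.divide dir q) (.divide dir q) false false false 0 E.base 0 0 0 1
        ∈ E.loopRules dir q d := by simp [loopRules]
    exact E.halts_mv (μ := .divide dir q) (ν := .divide dir q) (X := x) (Y := E.base * y + d)
      (Z := z) (E.loopRules_subset hq hd hR)
      (by simp) (by simp) (by simp) (ih (by rwa [add_comm z, ← add_assoc]))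

theorem halts_back {q : σ} (hq : q ∈ E.states) {d : ℕ} (hd : d < E.base) {dir : Bool} {y : ℕ} :
    ∀ {z x : ℕ}, Halts E.program (arr dir ((Ctl.divide dir q).code E.num) (x + z + d) y 0) →
      Halts E.program (arr dir ((Ctl.back dir q d).code E.num) x y z) := by
  intro z
  induction z with
  | zero =>
    intro x h
    have hR : E.mv dir (.back dir q d) (.divide dir q) false true false 0 0 0 d 0 0
        ∈ E.loopRules dir q d := by simp [loopRules]
    exact E.halts_mv (μ := .back dir q d) (ν := .divide dir q) (X := x) (Y := y) (Z := 0)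
      (E.loopRules_subset hq hd hR)
      (by simp) (by simp) (by simp) h
  | succ z ih =>
    intro x h
    have hR : E.mv dir (.back dir q d) (.back dir q d) false false false 0 0 1 1 0 0
        ∈ E.loopRules dir q d := by simp [loopRules]
    exact E.halts_mv (μ := .back dir q d) (ν := .back dir q d) (X := x) (Y := y) (Z := z)
      (E.loopRules_subset hq hd hR)
      (by simp) (by simp) (by simp) (ih (by rwa [add_assoc x, add_comm 1]))

theorem halts_scale {q : σ} (hq : q ∈ E.states) {d : ℕ} (hd : d < E.base) {dir : Bool} {y : ℕ} :
    ∀ {x z : ℕ},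
      Halts E.program (arr dir ((Ctl.divide dir q).code E.num) (E.base * x + z + d) y 0) →
      Halts E.program (arr dir ((Ctl.scale dir q d).code E.num) x y z) := by
  intro x
  induction x with
  | zero =>
    intro z h
    have hR : E.mv dir (.scale dir q d) (.back dir q d) false false true 0 0 0 0 0 0
        ∈ E.loopRules dir q d := by simp [loopRules]
    exact E.halts_mv (μ := .scale dir q d) (ν := .back dir q d) (X := 0) (Y := y) (Z := z)
      (E.loopRules_subset hq hd hR)
      (by simp) (by simp) (by simp) (E.halts_back hq hd (by rwa [mul_zero] at h))
  | succ x ih =>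
    intro z h
    have hR : E.mv dir (.scale dir q d) (.scale dir q d) false false false 1 0 0 0 0 E.base
        ∈ E.loopRules dir q d := by simp [loopRules]
    exact E.halts_mv (μ := .scale dir q d) (ν := .scale dir q d) (X := x) (Y := y) (Z := z)
      (E.loopRules_subset hq hd hR)
      (by simp) (by simp) (by simp)
      (ih (by rwa [show E.base * x + (z + E.base) + d = E.base * (x + 1) + z + d by ring]))

theorem halts_of_stops {q : σ} (hq : q ∈ E.states) {d : ℕ} (hd : d < E.base) {x y : ℕ}
    (h : E.Stops (E.conf (.run q d) true x y 0)) :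
    Halts E.program (arr true ((Ctl.run q d).code E.num) x y 0) := by
  obtain ⟨c, hc⟩ := Part.dom_iff_mem.1 h
  obtain ⟨hr, hn⟩ := StateTransition.mem_eval.1 hc
  generalize hs : E.conf (.run q d) true x y 0 = s at hr
  clear h hc
  have hb : 0 < E.base := by have := E.one_lt; omega
  induction hr using Relation.ReflTransGen.head_induction_on generalizing q d x y with
  | refl =>
    subst hs
    rw [E.step_conf_run, Option.map_eq_none_iff] at hn
    have hR : E.stepRule q d ∈ E.program := E.mem_program.2 ⟨q, hq, d, hd, .inl rfl⟩
    rw [stepRule, hn] at hR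
    have := Halts.accept hR rfl (arr true 0 x y 0)
      (by intro j; fin_cases j <;> simp [arr])
    simpa only [arr_add, zero_add, add_zero] using this
  | @head s s' hs' hr ih =>
    subst hs
    rw [Option.mem_def, E.step_conf_run] at hs'
    have hR : E.stepRule q d ∈ E.program := E.mem_program.2 ⟨q, hq, d, hd, .inl rfl⟩
    rw [stepRule] at hR
    rcases hm : E.mach q (E.sym d) with _ | ⟨q', (_ | _) | a⟩ <;>
      rw [hm] at hs' <;> simp only [hm] at hR <;>
      simp only [Option.map_none, Option.map_some, reduceCtorEq, Option.some.injEq] at hs'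
    · have hq' := E.closed _ hq _ _ _ hm
      have hmod : x % E.base < E.base := Nat.mod_lt _ hb
      refine E.halts_mv (X := y) (Y := x) (Z := 0) hR (by simp) (by simp) (by simp)
        (E.halts_scale hq' hd ?_)
      rw [← Nat.div_add_mod (x + 0) E.base]
      refine E.halts_divide hq' hmod ?_
      refine ih hq' hmod ?_
      rw [← hs']
      exact congrArg _ (E.move_tape false d y x hd).symm
    · have hq' := E.closed _ hq _ _ _ hm
      have hmod : y % E.base < E.base := Nat.mod_lt _ hb
      refine E.halts_mv (X := x) (Y := y) (Z := 0) hR (by simp) (by simp) (by simp)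
        (E.halts_scale hq' hd ?_)
      rw [← Nat.div_add_mod (y + 0) E.base]
      refine E.halts_divide hq' hmod ?_
      refine ih hq' hmod ?_
      rw [← hs']
      exact congrArg _ (E.move_tape true d x y hd).symm
    · refine E.halts_mv (X := x) (Y := y) (Z := 0) hR (by simp) (by simp) (by simp) ?_
      refine ih (E.closed _ hq _ _ _ hm) (E.dig_lt a) ?_
      rw [← hs']
      simp only [conf, sym_dig]
      rfl

/-- The program halts on the code of a configuration iff the machine does. -/
theorem halts_iff {q : σ} (hq : q ∈ E.states) {d : ℕ} (hd : d < E.base) {x y : ℕ} :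
    Halts E.program (arr true ((Ctl.run q d).code E.num) x y 0) ↔
      E.Stops ⟨q, ⟨E.sym d, E.half x, E.half y⟩⟩ :=
  ⟨fun h => E.sound_of_halts h (.run q d) true x y 0 hq trivial rfl, E.halts_of_stops hq hd⟩

end Numbered

end ThreeVar

namespace ThreeVar
open Paper

namespace Numbered

/-- A machine over a finite alphabet with finitely many reachable states can be numbered. -/
theorem exists_mach_eq {Γ σ : Type} [Inhabited Γ] [Fintype Γ] [Inhabited σ]
    (M : Turing.TM0.Machine Γ σ) (S : Finset σ) (hS : Turing.TM0.Supports M (S : Set σ)) :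
    ∃ E : Numbered Γ σ, E.mach = M ∧ E.states = S := by
  classical
  obtain ⟨num, hnum⟩ := Set.countable_iff_exists_injOn.1 S.countable_toSet
  let e := Fintype.equivFin Γ
  exact ⟨{
    mach := M
    states := S
    closed := fun q hq a q' s h => hS.2 (by rw [h]; rfl) hq
    num := num
    num_inj := hnum
    base := Fintype.card Γ + 2
    one_lt := by omega
    sym := fun n => if h : n - 1 < Fintype.card Γ ∧ n ≠ 0 then e.symm ⟨n - 1, h.1⟩ else default
    sym_zero := by simp
    dig := fun a => e a + 1
    dig_lt := fun a => by have := (e a).isLt; omega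
    sym_dig := fun a => by simp }, rfl, rfl⟩

variable {Γ σ : Type} [Inhabited Γ] [Inhabited σ] (E : Numbered Γ σ)

theorem half_ofDigits (l : List Γ) :
    E.half (Nat.ofDigits E.base (l.map E.dig)) = Turing.ListBlank.mk l := by
  induction l with
  | nil => exact E.half_zero
  | cons a l ih =>
    rw [List.map_cons, Nat.ofDigits_cons, Nat.add_comm, E.half_cons (E.dig_lt a), ih,
      E.sym_dig, Turing.ListBlank.cons_mk]

/-- The program halts on the code of an initial configuration iff the machine does. -/
theorem halts_init (hd : default ∈ E.states) (a : Γ) (l : List Γ) :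
    Halts E.program (arr true ((Ctl.run default (E.dig a)).code E.num) 0
      (Nat.ofDigits E.base (l.map E.dig)) 0) ↔ (Turing.TM0.eval E.mach (a :: l)).Dom := by
  rw [E.halts_iff hd (E.dig_lt a), E.half_ofDigits, E.sym_dig, E.half_zero]
  rfl

end Numbered

open Turing PartrecToTM2 in
instance : Fintype K' :=
  ⟨{.main, .rev, .aux, .stack}, fun k => by cases k <;> simp⟩

open Turing PartrecToTM2 in
/-- Every partial recursive function is semi-decided by a counter program whose input is read off
the binary expansion of the argument. -/
theorem exists_program {f : ℕ →. ℕ} (hf : Partrec f) :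
    ∃ (P : List Rule) (a b : ℕ) (d : PartrecToTM2.Γ' → ℕ), ∀ n,
      Halts P (arr true a 0 (Nat.ofDigits b ((trNat n).reverse.map d)) 0) ↔ (f n).Dom := by
  obtain ⟨c, hc⟩ := ToPartrec.Code.exists_code (Nat.Partrec'.part_iff₁.2 hf)
  let _ : Inhabited PartrecToTM2.Λ' := ⟨trNormal c Cont'.halt⟩
  have hs := TM1to0.tr_supports _ (TM2to1.tr_supports PartrecToTM2.tr (tr_supports c Cont'.halt))
  obtain ⟨E, hE, hE'⟩ := Numbered.exists_mach_eq _ _ hs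
  let s : PartrecToTM2.Γ' → TM2to1.Γ' K' (fun _ => PartrecToTM2.Γ') :=
    fun a => (false, Function.update (fun _ => none) K'.main (some a))
  refine ⟨E.program, (Ctl.run default (E.dig (true, (s .cons).2))).code E.num, E.base,
    E.dig ∘ s, fun n => ?_⟩
  have hr : (trList [n]).reverse = .cons :: (trNat n).reverse := by simp
  have hi : TM2to1.trInit K'.main (trList [n]) =
      (true, (s .cons).2) :: (trNat n).reverse.map s := by
    unfold TM2to1.trInit
    rw [hr]
    rfl
  have key := E.halts_init (hE' ▸ hs.1) (true, (s .cons).2) ((trNat n).reverse.map s)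
  rw [List.map_map, hE] at key
  refine key.trans ?_
  have h1 : TM0.eval (TM1to0.tr (TM2to1.tr PartrecToTM2.tr))
      ((true, (s .cons).2) :: (trNat n).reverse.map s) =
      TM1.eval (TM2to1.tr PartrecToTM2.tr) (TM2to1.trInit K'.main (trList [n])) :=
    (TM1to0.tr_eval _ _).trans (congrArg _ hi.symm)
  refine (iff_of_eq (congrArg Part.Dom h1)).trans ?_
  refine (TM2to1.tr_eval_dom PartrecToTM2.tr K'.main (trList [n])).trans ?_
  have h2 : TM2.init K'.main (trList [n]) = PartrecToTM2.init c [n] := by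
    unfold TM2.init PartrecToTM2.init
    congr 1
    funext k
    cases k <;> rfl
  change (StateTransition.eval (TM2.step tr) (TM2.init K'.main (trList [n]))).Dom ↔ _
  rw [h2, tr_eval]
  have := hc ⟨[n], rfl⟩
  rw [this]
  rfl

end ThreeVar

namespace ThreeVar
open Paper

/-! ### Primitive recursive families of formulas -/

/-- A family of formulas whose encodings are primitive recursive in the index. -/
def PrimFml (F : ℕ → Fml) : Prop := Primrec fun n => (F n).encode

theorem PrimFml.const (A : Fml) : PrimFml fun _ => A := Primrec.const _

theorem primrec₂_node (r : ℕ) : Primrec₂ fun a b : ℕ => 5 * Nat.pair a b + r :=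
  Primrec.nat_add.comp₂
    (Primrec.nat_mul.comp₂ (Primrec₂.const 5) Primrec₂.natPair) (Primrec₂.const r)

theorem PrimFml.and {F G : ℕ → Fml} (hF : PrimFml F) (hG : PrimFml G) :
    PrimFml fun n => (F n).and (G n) := (primrec₂_node 2).comp hF hG

theorem PrimFml.or {F G : ℕ → Fml} (hF : PrimFml F) (hG : PrimFml G) :
    PrimFml fun n => (F n).or (G n) := (primrec₂_node 3).comp hF hG

theorem PrimFml.imp {F G : ℕ → Fml} (hF : PrimFml F) (hG : PrimFml G) :
    PrimFml fun n => (F n).imp (G n) := (primrec₂_node 4).comp hF hG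

theorem PrimFml.conj {ι : Type} (l : List ι) {F : ι → ℕ → Fml} (hF : ∀ i, PrimFml (F i)) :
    PrimFml fun n => conj (l.map fun i => F i n) := by
  induction l with
  | nil => exact .const _
  | cons i l ih => exact (hF i).and ih

theorem PrimFml.disj {ι : Type} (l : List ι) {F : ι → ℕ → Fml} (hF : ∀ i, PrimFml (F i)) :
    PrimFml fun n => disj (l.map fun i => F i n) := by
  induction l with
  | nil => exact .const _
  | cons i l ih => exact (hF i).or ih

/-- The transition between the encodings of consecutive pairs of levels of a ladder. -/
def ladStep (j : Fin 4) (t : (ℕ × ℕ) × (ℕ × ℕ)) : (ℕ × ℕ) × (ℕ × ℕ) :=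
  let up (a b c : ℕ) : ℕ :=
    5 * Nat.pair (5 * Nat.pair (region j).encode a + 2) (5 * Nat.pair b c + 3) + 4
  (t.2, (up t.2.2 t.2.1 t.1.2, up t.2.1 t.2.2 t.1.1))

theorem primrec_ladStep (j : Fin 4) : Primrec (ladStep j) := by
  have up : ∀ {f g h : (ℕ × ℕ) × (ℕ × ℕ) → ℕ}, Primrec f → Primrec g → Primrec h →
      Primrec fun t => 5 * Nat.pair (5 * Nat.pair (region j).encode (f t) + 2)
        (5 * Nat.pair (g t) (h t) + 3) + 4 := fun hf hg hh =>
    (primrec₂_node 4).comp ((primrec₂_node 2).comp (.const _) hf) ((primrec₂_node 3).comp hg hh)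
  have h1 := Primrec.fst (α := ℕ × ℕ) (β := ℕ × ℕ)
  have h2 := Primrec.snd (α := ℕ × ℕ) (β := ℕ × ℕ)
  have k1 := Primrec.fst (α := ℕ) (β := ℕ)
  have k2 := Primrec.snd (α := ℕ) (β := ℕ)
  exact h2.pair ((up (k2.comp h2) (k1.comp h2) (k2.comp h1)).pair
    (up (k1.comp h2) (k2.comp h2) (k1.comp h1)))

theorem iterate_ladStep (j : Fin 4) (n : ℕ) :
    (ladStep j)^[n] (((lad j 0 true).encode, (lad j 0 false).encode),
      ((lad j 1 true).encode, (lad j 1 false).encode)) =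
    (((lad j n true).encode, (lad j n false).encode),
      ((lad j (n + 1) true).encode, (lad j (n + 1) false).encode)) := by
  induction n with
  | zero => rfl
  | succ n ih =>
    rw [Function.iterate_succ_apply', ih]
    rfl

theorem PrimFml.lad (j : Fin 4) (s : Bool) {u : ℕ → ℕ} (hu : Primrec u) :
    PrimFml fun n => lad j (u n) s := by
  have h := Primrec.fst.comp (Primrec.nat_iterate hu
    (Primrec.const (((ThreeVar.lad j 0 true).encode, (ThreeVar.lad j 0 false).encode),
      ((ThreeVar.lad j 1 true).encode, (ThreeVar.lad j 1 false).encode)))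
    ((primrec_ladStep j).comp₂ Primrec₂.right))
  simp only [iterate_ladStep] at h
  cases s
  · exact Primrec.snd.comp h
  · exact Primrec.fst.comp h

theorem PrimFml.mainFml {c : ℕ → Fin 4 → ℕ} (hc : ∀ j, Primrec fun n => c n j) :
    PrimFml fun n => mainFml (c n) := by
  refine (PrimFml.conj _ fun t => ?_).imp (PrimFml.disj _ fun t => ?_)
  · exact .lad _ _ (Primrec.nat_add.comp (hc t.1) (.const 3))
  · exact .lad _ _ (Primrec.nat_add.comp (hc t.1) (.const 2))

theorem PrimFml.acceptFml {c : ℕ → Fin 4 → ℕ} (hc : ∀ j, Primrec fun n => c n j) :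
    PrimFml fun n => acceptFml (c n) :=
  (PrimFml.const _).or ((PrimFml.const _).or (.mainFml hc))

/-! ### The numerical code of the input -/

open Turing.PartrecToTM2

/-- The least significant bit. -/
def lowBit (m : ℕ) : Γ' := if m % 2 = 0 then .bit0 else .bit1

theorem trNat_eq_cons {m : ℕ} (hm : m ≠ 0) : trNat m = lowBit m :: trNat (m / 2) := by
  have h := Num.ofNat'_bit m.bodd m.div2
  rw [Nat.bit_bodd_div2, Num.ofNat'_eq, Num.ofNat'_eq, Nat.div2_val] at h
  rw [lowBit, Nat.mod_two_of_bodd]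
  unfold trNat
  rw [h]
  have hd : m.bodd = false → ((m / 2 : ℕ) : Num) ≠ 0 := by
    intro hb h0
    have h0' : ((m / 2 : ℕ) : Num) = ((0 : ℕ) : Num) := by rw [h0, Nat.cast_zero]
    have := Num.to_of_nat (m / 2)
    rw [h0', Num.to_of_nat] at this
    have := Nat.mod_two_of_bodd m
    rw [hb] at this
    simp at this
    omega
  generalize ((m / 2 : ℕ) : Num) = x at hd
  cases hb : m.bodd
  · cases x
    · exact absurd rfl (hd hb)
    · rfl
  · cases x <;> rfl

/-- One step of the computation of the code of a number: its lowest bit is moved to the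
accumulator. -/
def shiftStep (b : ℕ) (d : Γ' → ℕ) (t : ℕ × ℕ) : ℕ × ℕ :=
  if t.1 = 0 then t else (t.1 / 2, t.2 * b + if t.1 % 2 = 0 then d .bit0 else d .bit1)

theorem iterate_shiftStep (b : ℕ) (d : Γ' → ℕ) (k m a : ℕ) (h : m ≤ k) :
    ((shiftStep b d)^[k] (m, a)).2 = (trNat m).foldl (fun a s => a * b + d s) a := by
  induction k generalizing m a with
  | zero =>
    obtain rfl : m = 0 := by omega
    simp
  | succ k ih =>
    rw [Function.iterate_succ_apply]
    by_cases hm : m = 0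
    · subst hm
      exact ih 0 a (by omega)
    · rw [trNat_eq_cons hm, List.foldl_cons, ← ih _ _ (by omega), shiftStep, if_neg hm, lowBit]
      split_ifs <;> rfl

theorem ofDigits_reverse (b : ℕ) (d : Γ' → ℕ) (l : List Γ') :
    Nat.ofDigits b (l.reverse.map d) = l.foldl (fun a s => a * b + d s) 0 := by
  rw [Nat.ofDigits_eq_foldr, List.foldr_map, List.foldr_reverse]
  simp [add_comm, mul_comm]

theorem primrec_shiftStep (b : ℕ) (d : Γ' → ℕ) : Primrec (shiftStep b d) := by
  have k1 := Primrec.fst (α := ℕ) (β := ℕ)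
  have k2 := Primrec.snd (α := ℕ) (β := ℕ)
  refine Primrec.ite (Primrec.eq.comp k1 (.const 0)) .id ?_
  refine (Primrec.nat_div.comp k1 (.const 2)).pair
    (Primrec.nat_add.comp (Primrec.nat_mul.comp k2 (.const b)) ?_)
  exact Primrec.ite (Primrec.eq.comp (Primrec.nat_mod.comp k1 (.const 2)) (.const 0))
    (.const _) (.const _)

theorem primrec_ofDigits_trNat (b : ℕ) (d : Γ' → ℕ) :
    Primrec fun n => Nat.ofDigits b ((trNat n).reverse.map d) := by
  have h := Primrec.snd.comp (Primrec.nat_iterate Primrec.id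
    (Primrec.id.pair (Primrec.const 0)) ((primrec_shiftStep b d).comp₂ Primrec₂.right))
  refine h.of_eq fun n => ?_
  rw [ofDigits_reverse]
  exact iterate_shiftStep b d n n 0 le_rfl

/-- Some vector system yields an undecidable calculus. -/
theorem exists_undecidable : ∃ P : List Rule, ¬ ∃ f : ℕ → Bool, Computable f ∧
    ∀ B : Fml, f B.encode = true ↔ Deriv {axiomFml P} B := by
  have hf : Partrec fun n : ℕ => (Denumerable.ofNat Nat.Partrec.Code n).eval 0 :=
    Nat.Partrec.Code.eval_part.comp (Computable.ofNat _) (Computable.const 0)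
  obtain ⟨P, a, b, d, h⟩ := exists_program hf
  refine ⟨P, fun ⟨f, hc, hB⟩ => ComputablePred.halting_problem 0 ?_⟩
  have hy : PrimFml fun n =>
      acceptFml (arr true a 0 (Nat.ofDigits b ((trNat n).reverse.map d)) 0) := by
    refine PrimFml.acceptFml fun j => ?_
    fin_cases j
    · exact Primrec.const a
    · exact Primrec.const 0
    · exact primrec_ofDigits_trNat b d
    · exact Primrec.const 0
  refine ComputablePred.computable_iff.2 ⟨_, hc.comp (hy.to_comp.comp Computable.encode), ?_⟩
  funext c
  refine propext ?_
  rw [hB, deriv_acceptFml_iff, h, Denumerable.ofNat_encode]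

end ThreeVar

/-- There exists a formula A containing only the 3 variables p,q,r
    such that Int + A is undecidable: no computable function decides (via the
    encoding of formulas into ℕ) membership in the set of derivable formulas. -/
theorem statement0 :
    ∃ A : Paper.Fml, A.vars ⊆ ({0, 1, 2} : Finset ℕ) ∧
      ¬ ∃ f : ℕ → Bool, Computable f ∧
        ∀ B : Paper.Fml, (f B.encode = true ↔ Paper.Deriv {A} B) := by
  obtain ⟨P, hP⟩ := ThreeVar.exists_undecidable
  exact ⟨ThreeVar.axiomFml P, ThreeVar.vars_axiomFml P, hP⟩
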